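/- Under the stated hypotheses, the Orbit 6 (L,K,K) three-term relation holds: S(a)·A(1+a−f, 1+b−f, 1+c−f, 1+d−f)·A(1+a−g, 1+b−g, 1+c−g, 1+d−g)·A(1−a, e−a, f−a, g−a)·K(a;b,c,d;e,f,g) − A(a, 1+a−e, 1+a−f, 1+a−g)·B_4(a,b,c,d,e,f,g)·K(e−a; e−b, e−c, e−d; e, 1+e−f, 1+e−g) − A(a,b,c,d)·B_2(a,b,c,d,e,f,g)·L(1−a, 1−b, 1−c, 1−d; 2−e; 2−f, 2−g) = 0. -/

import Mathlib

noncomputable section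

open Complex

/-- `Sn x = sin (π x)`. -/
def Sn (x : ℂ) : ℂ := Complex.sin ((Real.pi : ℂ) * x)

/-- The renormalized Saalschützian series
`F*(a,b,c,d;e,f,g) = ∑ₖ Γ(k+a)Γ(k+b)Γ(k+c)Γ(k+d)/(k!·Γ(k+e)Γ(k+f)Γ(k+g))`. -/
def Fstar (a b c d e f g : ℂ) : ℂ :=
  ∑' k : ℕ, (Complex.Gamma (k + a) * Complex.Gamma (k + b) *
      Complex.Gamma (k + c) * Complex.Gamma (k + d)) /
    ((k.factorial : ℂ) * Complex.Gamma (k + e) * Complex.Gamma (k + f) *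
      Complex.Gamma (k + g))

/-- The function `K(a;b,c,d;e,f,g)`. -/
def Kf (a b c d e f g : ℂ) : ℂ :=
  (Fstar a b c d e f g +
      Fstar a (1 + a - e) (1 + a - f) (1 + a - g) (1 + a - b) (1 + a - c) (1 + a - d)) /
    (Sn a * Complex.Gamma a ^ 2 * Complex.Gamma b * Complex.Gamma c * Complex.Gamma d *
      Complex.Gamma (1 + a - e) * Complex.Gamma (1 + a - f) * Complex.Gamma (1 + a - g))

/-- The function `L(a,b,c,d;e;f,g)`. -/
def Lf (a b c d e f g : ℂ) : ℂ :=
  (Fstar a b c d e f g -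
      Fstar (1 + a - e) (1 + b - e) (1 + c - e) (1 + d - e) (2 - e) (1 + f - e) (1 + g - e)) /
    (Sn e * Complex.Gamma a * Complex.Gamma b * Complex.Gamma c * Complex.Gamma d *
      Complex.Gamma (1 + a - e) * Complex.Gamma (1 + b - e) * Complex.Gamma (1 + c - e) *
      Complex.Gamma (1 + d - e))

/-- `A(x,y,z,t) = 1/(Γ(x)Γ(y)Γ(z)Γ(t))`. -/
def Af (x y z t : ℂ) : ℂ :=
  1 / (Complex.Gamma x * Complex.Gamma y * Complex.Gamma z * Complex.Gamma t)

def B1 (a b c d e f g : ℂ) : ℂ :=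
  Sn b * Sn c * (Sn (b - a) * Sn (c - a) * Sn d + Sn (e - a) * Sn (f - a) * Sn (g - a)) /
    (Real.pi : ℂ) ^ 4

def B2 (a b c d e f g : ℂ) : ℂ :=
  Sn (f - a) * Sn (g - a) *
    (Sn (b - a) * Sn (c - a) * Sn (d - a) + Sn (e - 2 * a) * Sn (f - a) * Sn (g - a)) /
    (Real.pi : ℂ) ^ 4

def B3 (a b c d e f g : ℂ) : ℂ :=
  (Sn f * Sn (f - e) * Sn (g - a) * Sn (g - b) * Sn (g - c) * Sn (g - d) -
      Sn g * Sn (g - e) * Sn (f - a) * Sn (f - b) * Sn (f - c) * Sn (f - d)) /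
    ((Real.pi : ℂ) ^ 4 * Sn (f - g))

def B4 (a b c d e f g : ℂ) : ℂ :=
  Sn (f - a) * Sn (g - a) * (Sn b * Sn c * Sn d + Sn (e - a) * Sn f * Sn g) /
    (Real.pi : ℂ) ^ 4

def B5 (a b c d e f g : ℂ) : ℂ :=
  Sn b * Sn (e - b) *
    (Sn (b - a) * Sn (c - a) * Sn (d - a) + Sn (e - 2 * a) * Sn (f - a) * Sn (g - a)) /
    (Real.pi : ℂ) ^ 4

def Cf (a b c d e f g : ℂ) : ℂ :=
  Sn (e - a) * (Sn b * Sn c * Sn d * B2 a b c d e f g +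
      Sn e * Sn (f - a) * Sn (g - a) * B4 a b c d e f g) / (Real.pi : ℂ) ^ 4

open Filter Topology Finset
open scoped Nat

/-! ### Asymptotics of Gamma quotients -/

lemma Gamma_add_nat_eq_prod (z : ℂ) (hz : ∀ m : ℕ, z ≠ -m) (n : ℕ) :
    Complex.Gamma (z + n) = Complex.Gamma z * ∏ j ∈ range n, (z + j) := by
  induction n with
  | zero => simp
  | succ n ih =>
    have h : z + n ≠ 0 := fun h => hz n (by linear_combination h)
    rw [Nat.cast_succ, ← add_assoc, Complex.Gamma_add_one _ h, ih, prod_range_succ]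
    ring

lemma tendsto_cpow_mul_factorial_div_Gamma (z : ℂ) (hz : ∀ m : ℕ, z ≠ -m) :
    Tendsto (fun n : ℕ => (n : ℂ) ^ z * (n ! : ℂ) / Complex.Gamma (z + n + 1)) atTop (𝓝 1) := by
  have h0 : Complex.Gamma z ≠ 0 := Complex.Gamma_ne_zero hz
  have h := (Complex.GammaSeq_tendsto_Gamma z).div_const (Complex.Gamma z)
  rw [div_self h0] at h
  refine h.congr fun n => ?_
  have := Gamma_add_nat_eq_prod z hz (n + 1)
  push_cast at this
  rw [← add_assoc] at this
  rw [this, Complex.GammaSeq, div_div, mul_comm (Complex.Gamma z)]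

lemma tendsto_cpow_mul_prod_Gamma_div {k : ℕ} (x y : Fin k → ℂ)
    (hx : ∀ i, ∀ m : ℕ, x i ≠ -m) (hy : ∀ i, ∀ m : ℕ, y i ≠ -m) :
    Tendsto (fun n : ℕ => (n : ℂ) ^ (∑ i, y i - ∑ i, x i) *
      ∏ i, (Complex.Gamma (x i + n + 1) / Complex.Gamma (y i + n + 1))) atTop (𝓝 1) := by
  have h : Tendsto (fun n : ℕ => ∏ i : Fin k,
      ((n : ℂ) ^ y i * (n ! : ℂ) / Complex.Gamma (y i + n + 1)) /
      ((n : ℂ) ^ x i * (n ! : ℂ) / Complex.Gamma (x i + n + 1))) atTop (𝓝 (∏ _i : Fin k, 1 / 1)) :=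
    tendsto_finsetProd _ fun i _ =>
      (tendsto_cpow_mul_factorial_div_Gamma _ (hy i)).div
        (tendsto_cpow_mul_factorial_div_Gamma _ (hx i)) one_ne_zero
  rw [div_one, prod_const_one] at h
  refine h.congr' ?_
  filter_upwards [eventually_gt_atTop 0] with n hn
  have hn' : (n : ℂ) ≠ 0 := by exact_mod_cast hn.ne'
  have key : (n : ℂ) ^ (∑ i, y i - ∑ i, x i) = ∏ i, ((n : ℂ) ^ y i / (n : ℂ) ^ x i) := by
    simp_rw [← Complex.cpow_sub _ _ hn', Complex.cpow_def_of_ne_zero hn', ← Complex.exp_sum,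
      ← mul_sum, sum_sub_distrib]
  rw [key, ← prod_mul_distrib]
  refine prod_congr rfl fun i _ => ?_
  have h1 : (n : ℂ) ^ x i ≠ 0 := by simp [Complex.cpow_eq_zero_iff, hn']
  have h2 : (n ! : ℂ) ≠ 0 := by exact_mod_cast n.factorial_ne_zero
  by_cases h3 : Complex.Gamma (x i + n + 1) = 0
  · simp [h3]
  by_cases h4 : Complex.Gamma (y i + n + 1) = 0
  · simp [h4]
  field_simp

lemma tendsto_rpow_mul_prod_Gamma_div {k : ℕ} (x y : Fin k → ℝ)
    (hx : ∀ i, 0 < x i) (hy : ∀ i, 0 < y i) :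
    Tendsto (fun n : ℕ => (n : ℝ) ^ (∑ i, y i - ∑ i, x i) *
      ∏ i, (Real.Gamma (x i + n + 1) / Real.Gamma (y i + n + 1))) atTop (𝓝 1) := by
  have aux : ∀ r : ℝ, 0 < r → ∀ m : ℕ, (r : ℂ) ≠ -m := fun r hr m h => by
    have : r = -m := by exact_mod_cast h
    have := m.cast_nonneg (α := ℝ)
    linarith
  have h := tendsto_cpow_mul_prod_Gamma_div (fun i => (x i : ℂ)) (fun i => (y i : ℂ))
    (fun i => aux _ (hx i)) (fun i => aux _ (hy i))
  rw [← tendsto_ofReal_iff, Complex.ofReal_one]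
  refine h.congr fun n => ?_
  rw [Complex.ofReal_mul, Complex.ofReal_cpow (Nat.cast_nonneg n)]
  simp [← Complex.Gamma_ofReal]

/-! ### Gauss's summation theorem for real parameters -/

lemma tendsto_Gamma_quotient_two {x₁ x₂ y₁ y₂ : ℝ} (hx₁ : 0 < x₁) (hx₂ : 0 < x₂)
    (hy₁ : 0 < y₁) (hy₂ : 0 < y₂) :
    Tendsto (fun n : ℕ => (n : ℝ) ^ (y₁ + y₂ - x₁ - x₂) *
      (Real.Gamma (n + 1 + x₁) * Real.Gamma (n + 1 + x₂) /
        (Real.Gamma (n + 1 + y₁) * Real.Gamma (n + 1 + y₂)))) atTop (𝓝 1) := by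
  have h := tendsto_rpow_mul_prod_Gamma_div ![x₁, x₂] ![y₁, y₂]
    (by simp [Fin.forall_fin_two, hx₁, hx₂]) (by simp [Fin.forall_fin_two, hy₁, hy₂])
  refine h.congr fun n => ?_
  simp only [Fin.sum_univ_two, Fin.prod_univ_two, Matrix.cons_val_zero, Matrix.cons_val_one]
  rw [div_mul_div_comm, ← sub_sub]
  simp only [add_comm, add_assoc]

lemma tendsto_Gamma_quotient_two_one {x₁ x₂ y₁ y₂ : ℝ} (hx₁ : 0 < x₁) (hx₂ : 0 < x₂)
    (hy₁ : 0 < y₁) (hy₂ : 0 < y₂) (h : x₁ + x₂ = y₁ + y₂) :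
    Tendsto (fun n : ℕ => Real.Gamma (n + x₁) * Real.Gamma (n + x₂) /
        (Real.Gamma (n + y₁) * Real.Gamma (n + y₂))) atTop (𝓝 1) := by
  rw [← tendsto_add_atTop_iff_nat 1]
  refine (tendsto_Gamma_quotient_two hx₁ hx₂ hy₁ hy₂).congr fun n => ?_
  rw [show y₁ + y₂ - x₁ - x₂ = 0 by linarith, Real.rpow_zero, one_mul]
  push_cast
  rfl

lemma tendsto_Gamma_quotient_three_one {x₁ x₂ x₃ y₁ y₂ y₃ : ℝ} (hx₁ : 0 < x₁) (hx₂ : 0 < x₂)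
    (hx₃ : 0 < x₃) (hy₁ : 0 < y₁) (hy₂ : 0 < y₂) (hy₃ : 0 < y₃)
    (h : x₁ + x₂ + x₃ = y₁ + y₂ + y₃) :
    Tendsto (fun n : ℕ => Real.Gamma (n + x₁) * Real.Gamma (n + x₂) * Real.Gamma (n + x₃) /
        (Real.Gamma (n + y₁) * Real.Gamma (n + y₂) * Real.Gamma (n + y₃))) atTop (𝓝 1) := by
  rw [← tendsto_add_atTop_iff_nat 1]
  have h' := tendsto_rpow_mul_prod_Gamma_div ![x₁, x₂, x₃] ![y₁, y₂, y₃]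
    (by simp [Fin.forall_fin_succ, hx₁, hx₂, hx₃]) (by simp [Fin.forall_fin_succ, hy₁, hy₂, hy₃])
  refine h'.congr fun n => ?_
  simp only [Fin.sum_univ_three, Fin.prod_univ_three, Matrix.cons_val_zero, Matrix.cons_val_one,
    Matrix.cons_val]
  rw [div_mul_div_comm, div_mul_div_comm, ← h, sub_self, Real.rpow_zero, one_mul]
  push_cast
  simp only [add_comm, add_assoc]

lemma summable_of_tendsto_rpow_mul {u : ℕ → ℝ} {p : ℝ} (hp : 1 < p)
    (h : Tendsto (fun n : ℕ => (n : ℝ) ^ p * u n) atTop (𝓝 1)) : Summable u := by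
  refine summable_of_isBigO_nat (Real.summable_nat_rpow.2 (neg_lt_neg hp)) ?_
  have h1 := h.isBigO_one ℝ
  have h2 := (Asymptotics.isBigO_refl (fun n : ℕ => (n : ℝ) ^ (-p)) atTop).mul h1
  refine h2.congr' ?_ (by simp)
  filter_upwards [eventually_gt_atTop 0] with n hn
  have hn' : (0 : ℝ) < n := by exact_mod_cast hn
  rw [← mul_assoc, ← Real.rpow_add hn', neg_add_cancel, Real.rpow_zero, one_mul]

lemma tendsto_mul_zero_of_tendsto_rpow_mul {u : ℕ → ℝ} {p : ℝ} (hp : 1 < p)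
    (h : Tendsto (fun n : ℕ => (n : ℝ) ^ p * u n) atTop (𝓝 1)) :
    Tendsto (fun n : ℕ => ((n : ℝ) + 1) * u n) atTop (𝓝 0) := by
  have h1 : Tendsto (fun n : ℕ => (n : ℝ) ^ (-(p - 1))) atTop (𝓝 0) :=
    (tendsto_rpow_neg_atTop (by linarith)).comp tendsto_natCast_atTop_atTop
  have h3 : Tendsto (fun n : ℕ => (n : ℝ) * u n) atTop (𝓝 0) := by
    have h2 := h1.mul h
    rw [zero_mul] at h2
    refine h2.congr' ?_
    filter_upwards [eventually_gt_atTop 0] with n hn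
    have hn' : (0 : ℝ) < n := by exact_mod_cast hn
    rw [← mul_assoc, ← Real.rpow_add hn', neg_sub, sub_add_cancel, Real.rpow_one]
  have h4 := h3.add (summable_of_tendsto_rpow_mul hp h).tendsto_atTop_zero
  rw [add_zero] at h4
  exact h4.congr fun n => by ring

lemma tsum_eq_of_telescoping {u G : ℕ → ℝ} {L : ℝ} (hu : Summable u)
    (h : ∀ n, u n = G (n + 1) - G n) (hG : Tendsto G atTop (𝓝 L)) : ∑' n, u n = L - G 0 := by
  refine tendsto_nhds_unique hu.hasSum.tendsto_sum_nat ?_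
  simp_rw [h, sum_range_sub]
  exact hG.sub_const _

lemma real_Gamma_nat_add_eq_prod {z : ℝ} (hz : 0 < z) (n : ℕ) :
    Real.Gamma (n + z) = Real.Gamma z * ∏ j ∈ range n, (z + j) := by
  induction n with
  | zero => simp
  | succ n ih =>
    have h : (n : ℝ) + z ≠ 0 := by positivity
    rw [Nat.cast_succ, add_right_comm, Real.Gamma_add_one h, ih, prod_range_succ]
    ring

lemma real_Gamma_nat_add_succ {z : ℝ} (n : ℕ) (h : (n : ℝ) + z ≠ 0) :
    Real.Gamma (((n + 1 : ℕ) : ℝ) + z) = (n + z) * Real.Gamma (n + z) := by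
  rw [Nat.cast_succ, add_right_comm, Real.Gamma_add_one h]

lemma real_Gamma_add_add_one {x z : ℝ} (h : x + z ≠ 0) :
    Real.Gamma (x + (z + 1)) = (x + z) * Real.Gamma (x + z) := by
  rw [← add_assoc, Real.Gamma_add_one h]

/-- The general term of Gauss's series. -/
def gaussTerm (a b c : ℝ) (n : ℕ) : ℝ :=
  Real.Gamma (n + a) * Real.Gamma (n + b) / (n ! * Real.Gamma (n + c))

lemma gaussTerm_pos {a b c : ℝ} (ha : 0 < a) (hb : 0 < b) (hc : 0 < c) (n : ℕ) :
    0 < gaussTerm a b c n := by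
  have h1 := Real.Gamma_pos_of_pos (by positivity : 0 < n + a)
  have h2 := Real.Gamma_pos_of_pos (by positivity : 0 < n + b)
  have h3 := Real.Gamma_pos_of_pos (by positivity : 0 < n + c)
  rw [gaussTerm]
  positivity

lemma tendsto_rpow_mul_gaussTerm {a b c : ℝ} (ha : 0 < a) (hb : 0 < b) (hc : 0 < c) :
    Tendsto (fun n : ℕ => (n : ℝ) ^ (1 + c - a - b) * gaussTerm a b c (n + 1)) atTop (𝓝 1) := by
  refine (tendsto_Gamma_quotient_two ha hb one_pos hc).congr fun n => ?_
  rw [gaussTerm, ← Real.Gamma_nat_eq_factorial]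
  push_cast
  rfl

lemma summable_gaussTerm {a b c : ℝ} (ha : 0 < a) (hb : 0 < b) (h : a + b < c) :
    Summable (gaussTerm a b c) :=
  (summable_nat_add_iff 1).1
    (summable_of_tendsto_rpow_mul (by linarith) (tendsto_rpow_mul_gaussTerm ha hb (by linarith)))

lemma tendsto_mul_gaussTerm {a b c : ℝ} (ha : 0 < a) (hb : 0 < b) (h : a + b < c) :
    Tendsto (fun n : ℕ => (n : ℝ) * gaussTerm a b c n) atTop (𝓝 0) := by
  rw [← tendsto_add_atTop_iff_nat 1]
  refine (tendsto_mul_zero_of_tendsto_rpow_mul (by linarith)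
    (tendsto_rpow_mul_gaussTerm ha hb (by linarith : 0 < c))).congr fun n => ?_
  push_cast
  rfl

lemma tsum_gaussTerm_add_one {a b c : ℝ} (ha : 0 < a) (hb : 0 < b) (h : a + b < c) :
    (c - a) * (c - b) * ∑' n, gaussTerm a b (c + 1) n = (c - a - b) * ∑' n, gaussTerm a b c n := by
  have s1 := (summable_gaussTerm ha hb (by linarith : a + b < c + 1)).mul_left ((c - a) * (c - b))
  have s2 := (summable_gaussTerm ha hb h).mul_left (c - a - b)
  have key := tsum_eq_of_telescoping (s1.sub s2) (G := fun n => (n : ℝ) * gaussTerm a b c n) ?_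
    (tendsto_mul_gaussTerm ha hb h)
  · rw [s1.tsum_sub s2, tsum_mul_left, tsum_mul_left] at key
    simpa [sub_eq_zero] using key
  · intro n
    have hc : (n : ℝ) + c ≠ 0 := by have := n.cast_nonneg (α := ℝ); linarith
    have h3 := Real.Gamma_pos_of_pos (by linarith [n.cast_nonneg (α := ℝ)] : 0 < n + c)
    have h4 : (n ! : ℝ) ≠ 0 := by exact_mod_cast n.factorial_ne_zero
    simp only [gaussTerm]
    rw [real_Gamma_add_add_one hc, real_Gamma_nat_add_succ n hc,
      real_Gamma_nat_add_succ n (by positivity : (n : ℝ) + a ≠ 0),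
      real_Gamma_nat_add_succ n (by positivity : (n : ℝ) + b ≠ 0), Nat.factorial_succ]
    push_cast
    field_simp
    ring

lemma tendsto_Gamma_mul_tsum_gaussTerm {a b c : ℝ} (ha : 0 < a) (hb : 0 < b) (h : a + b < c) :
    Tendsto (fun j : ℕ => Real.Gamma (j + c) * ∑' n, gaussTerm a b (j + c) n) atTop
      (𝓝 (Real.Gamma a * Real.Gamma b)) := by
  have hc : 0 < c := by linarith
  have hlim : Real.Gamma a * Real.Gamma b = ∑' n : ℕ,
      Real.Gamma (n + a) * Real.Gamma (n + b) / n ! * ∏ _j ∈ range n, (0 : ℝ) := by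
    rw [tsum_eq_single 0 (by intro n hn; simp [hn])]
    simp
  have hterm : ∀ j n : ℕ, Real.Gamma (j + c) * gaussTerm a b (j + c) n =
      Real.Gamma (n + a) * Real.Gamma (n + b) / n ! * ∏ i ∈ range n, (j + c + i)⁻¹ := by
    intro j n
    have hj : 0 < j + c := by positivity
    have := Real.Gamma_pos_of_pos hj
    have h5 : ∏ i ∈ range n, (j + c + (i : ℝ)) ≠ 0 := prod_ne_zero_iff.2 fun i _ => by positivity
    rw [gaussTerm, real_Gamma_nat_add_eq_prod hj, prod_inv_distrib]
    field_simp
  simp_rw [← tsum_mul_left, hterm, hlim]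
  refine tendsto_tsum_of_dominated_convergence
    (bound := fun n => Real.Gamma c * gaussTerm a b c n)
    ((summable_gaussTerm ha hb h).mul_left _) (fun n => ?_) (Eventually.of_forall fun j n => ?_)
  · refine (tendsto_finsetProd _ fun i _ => ?_).const_mul _
    refine tendsto_inv_atTop_zero.comp ?_
    simp_rw [add_assoc]
    exact tendsto_atTop_add_const_right _ _ tendsto_natCast_atTop_atTop
  · have h1 := Real.Gamma_pos_of_pos (by positivity : 0 < n + a)
    have h2 := Real.Gamma_pos_of_pos (by positivity : 0 < n + b)
    have h0 := hterm 0 n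
    simp only [CharP.cast_eq_zero, zero_add] at h0
    rw [h0, Real.norm_of_nonneg
      (mul_nonneg (by positivity) (prod_nonneg fun i _ => by positivity))]
    gcongr
    linarith [j.cast_nonneg (α := ℝ)]

theorem tsum_gaussTerm {a b c : ℝ} (ha : 0 < a) (hb : 0 < b) (h : a + b < c) :
    ∑' n, gaussTerm a b c n = Real.Gamma a * Real.Gamma b * Real.Gamma (c - a - b) /
      (Real.Gamma (c - a) * Real.Gamma (c - b)) := by
  have g1 := Real.Gamma_pos_of_pos (by linarith : 0 < c - a - b)
  have g2 := Real.Gamma_pos_of_pos (by linarith : 0 < c - a)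
  have g3 := Real.Gamma_pos_of_pos (by linarith : 0 < c - b)
  have hconst : ∀ j : ℕ, (∑' n, gaussTerm a b (j + c) n) *
      (Real.Gamma (j + (c - a)) * Real.Gamma (j + (c - b)) / Real.Gamma (j + (c - a - b))) =
      (∑' n, gaussTerm a b c n) *
      (Real.Gamma (c - a) * Real.Gamma (c - b) / Real.Gamma (c - a - b)) := by
    intro j
    induction j with
    | zero => simp
    | succ j ih =>
      have hj := j.cast_nonneg (α := ℝ)
      have k1 := Real.Gamma_pos_of_pos (by linarith : 0 < j + (c - a - b))
      have k2 : (j : ℝ) + (c - a - b) ≠ 0 := by linarith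
      have step := tsum_gaussTerm_add_one ha hb (by linarith : a + b < j + c)
      rw [← ih, real_Gamma_nat_add_succ j (by linarith : (j : ℝ) + (c - a) ≠ 0),
        real_Gamma_nat_add_succ j (by linarith : (j : ℝ) + (c - b) ≠ 0),
        real_Gamma_nat_add_succ j k2, Nat.cast_succ, add_right_comm (j : ℝ) 1 c]
      field_simp
      linear_combination Real.Gamma (j + (c - a)) * Real.Gamma (j + (c - b)) * step
  have hl := (tendsto_Gamma_mul_tsum_gaussTerm ha hb h).mul (tendsto_Gamma_quotient_two_one
    (by linarith : 0 < c - a) (by linarith : 0 < c - b) (by linarith : 0 < c - a - b)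
    (by linarith : 0 < c) (by ring))
  rw [mul_one] at hl
  have hl' := tendsto_nhds_unique (hl.congr fun j => ?_) (tendsto_const_nhds
    (x := (∑' n, gaussTerm a b c n) *
      (Real.Gamma (c - a) * Real.Gamma (c - b) / Real.Gamma (c - a - b))))
  · rw [eq_div_iff (by positivity), hl']
    field_simp
  · have := Real.Gamma_pos_of_pos (by linarith [j.cast_nonneg (α := ℝ)] : 0 < j + c)
    rw [← hconst j]
    field_simp

/-! ### The nonterminating Saalschütz summation for real parameters -/

/-- The general term of the series `₃F₂(a, b, c; e, c + h)`, with Gamma factors. -/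
def saalTerm (a b c e h : ℝ) (n : ℕ) : ℝ :=
  Real.Gamma (n + a) * Real.Gamma (n + b) * Real.Gamma (n + c) /
    (n ! * Real.Gamma (n + e) * Real.Gamma (n + (c + h)))

lemma saalTerm_pos {a b c e h : ℝ} (ha : 0 < a) (hb : 0 < b) (hc : 0 < c) (he : 0 < e)
    (hh : 0 < h) (n : ℕ) : 0 < saalTerm a b c e h n := by
  have h1 := Real.Gamma_pos_of_pos (by positivity : 0 < n + a)
  have h2 := Real.Gamma_pos_of_pos (by positivity : 0 < n + b)
  have h3 := Real.Gamma_pos_of_pos (by positivity : 0 < n + c)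
  have h4 := Real.Gamma_pos_of_pos (by positivity : 0 < n + e)
  have h5 := Real.Gamma_pos_of_pos (by positivity : 0 < n + (c + h))
  rw [saalTerm]
  positivity

lemma summable_saalTerm {a b c e h : ℝ} (ha : 0 < a) (hb : 0 < b) (hc : 0 < c) (he : 0 < e)
    (hh : 0 < h) (H : a + b < e + h) : Summable (saalTerm a b c e h) := by
  rw [← summable_nat_add_iff 1]
  have h' := tendsto_rpow_mul_prod_Gamma_div ![a, b, c] ![1, e, c + h]
    (by simp [Fin.forall_fin_succ, ha, hb, hc])
    (by simp [Fin.forall_fin_succ, he, add_pos hc hh])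
  simp only [Fin.sum_univ_three, Fin.prod_univ_three, Matrix.cons_val_zero, Matrix.cons_val_one,
    Matrix.cons_val] at h'
  refine summable_of_tendsto_rpow_mul (p := 1 + e + (c + h) - (a + b + c)) (by linarith)
    (h'.congr fun n => ?_)
  rw [saalTerm, ← Real.Gamma_nat_eq_factorial, div_mul_div_comm, div_mul_div_comm]
  push_cast
  simp only [add_comm, add_assoc]

lemma saalTerm_contiguous {a b c e h : ℝ} (ha : 0 < a) (hb : 0 < b) (hc : 0 < c) (he : 0 < e)
    (hh : 0 < h) (H : h + e = 1 + a + b) (n : ℕ) :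
    (c + h - a) * (c + h - b) * saalTerm a b (c + 1) e h n -
      c * (c + 1 - e) * saalTerm a b c e h n =
    ((n + 1 : ℕ) : ℝ) * ((n + 1 : ℕ) + e - 1) * saalTerm a b c e h (n + 1) -
      n * (n + e - 1) * saalTerm a b c e h n := by
  have h4 : (n ! : ℝ) ≠ 0 := by exact_mod_cast n.factorial_ne_zero
  have g1 := Real.Gamma_pos_of_pos (by positivity : 0 < n + e)
  have g2 := Real.Gamma_pos_of_pos (by positivity : 0 < n + (c + h))
  obtain rfl : h = 1 + a + b - e := by linarith
  simp only [saalTerm]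
  rw [show c + 1 + (1 + a + b - e) = c + (1 + a + b - e) + 1 by ring,
    real_Gamma_add_add_one (by positivity : n + (c + (1 + a + b - e)) ≠ 0),
    real_Gamma_add_add_one (by positivity : n + c ≠ 0),
    real_Gamma_nat_add_succ n (by positivity : n + (c + (1 + a + b - e)) ≠ 0),
    real_Gamma_nat_add_succ n (by positivity : (n : ℝ) + a ≠ 0),
    real_Gamma_nat_add_succ n (by positivity : (n : ℝ) + b ≠ 0),
    real_Gamma_nat_add_succ n (by positivity : (n : ℝ) + c ≠ 0),
    real_Gamma_nat_add_succ n (by positivity : (n : ℝ) + e ≠ 0), Nat.factorial_succ]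
  have h5 : n + (c + (1 + a + b - e)) ≠ 0 := by positivity
  push_cast
  generalize Real.Gamma (n + (c + (1 + a + b - e))) = X at *
  field_simp
  ring

lemma tendsto_mul_mul_saalTerm {a b c e h : ℝ} (ha : 0 < a) (hb : 0 < b) (hc : 0 < c)
    (he : 0 < e) (hh : 0 < h) (H : h + e = 1 + a + b) :
    Tendsto (fun n : ℕ => (n : ℝ) * (n + e - 1) * saalTerm a b c e h n) atTop (𝓝 1) := by
  rw [← tendsto_add_atTop_iff_nat 1]
  refine (tendsto_Gamma_quotient_three_one (by linarith : 0 < a + 1) (by linarith : 0 < b + 1)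
    (by linarith : 0 < c + 1) one_pos he (by linarith : 0 < c + h + 1)
    (by linarith)).congr fun n => ?_
  have h4 : (n ! : ℝ) ≠ 0 := by exact_mod_cast n.factorial_ne_zero
  have g1 := Real.Gamma_pos_of_pos (by positivity : 0 < n + e)
  have g2 := Real.Gamma_pos_of_pos (by positivity : 0 < n + (c + h + 1))
  rw [saalTerm, real_Gamma_nat_add_succ n (by positivity : (n : ℝ) + e ≠ 0), Nat.factorial_succ,
    Real.Gamma_nat_eq_factorial]
  push_cast
  simp only [add_right_comm (n : ℝ) 1, ← add_assoc] at *
  field_simp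
  ring

lemma tsum_saalTerm_contiguous {a b c e h : ℝ} (ha : 0 < a) (hb : 0 < b) (hc : 0 < c)
    (he : 0 < e) (hh : 0 < h) (H : h + e = 1 + a + b) :
    (c + h - a) * (c + h - b) * ∑' n, saalTerm a b (c + 1) e h n -
      c * (c + 1 - e) * ∑' n, saalTerm a b c e h n = 1 := by
  have s1 := (summable_saalTerm ha hb (by linarith : 0 < c + 1) he hh (by linarith)).mul_left
    ((c + h - a) * (c + h - b))
  have s2 := (summable_saalTerm ha hb hc he hh (by linarith)).mul_left (c * (c + 1 - e))
  have key := tsum_eq_of_telescoping (s1.sub s2)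
    (G := fun n => (n : ℝ) * (n + e - 1) * saalTerm a b c e h n)
    (fun n => saalTerm_contiguous ha hb hc he hh H n)
    (tendsto_mul_mul_saalTerm ha hb hc he hh H)
  rw [s1.tsum_sub s2, tsum_mul_left, tsum_mul_left] at key
  simpa using key

lemma tendsto_Gamma_div_mul_tsum_saalTerm {a b c e h : ℝ} (ha : 0 < a) (hb : 0 < b) (hc : 0 < c)
    (he : a + b < e) (hh : 0 < h) :
    Tendsto (fun j : ℕ => Real.Gamma (j + (c + h)) / Real.Gamma (j + c) *
      ∑' n, saalTerm a b (j + c) e h n) atTop (𝓝 (∑' n, gaussTerm a b e n)) := by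
  have he' : 0 < e := by linarith
  have hterm : ∀ j n : ℕ, Real.Gamma (j + (c + h)) / Real.Gamma (j + c) *
      saalTerm a b (j + c) e h n =
      gaussTerm a b e n * ∏ i ∈ range n, ((j + c + i) / (j + c + i + h)) := by
    intro j n
    have hj : 0 < j + c := by positivity
    have hj' : 0 < j + c + h := by positivity
    have g1 := Real.Gamma_pos_of_pos hj
    have g2 := Real.Gamma_pos_of_pos hj'
    have h5 : ∏ i ∈ range n, (j + c + i + h) ≠ 0 := prod_ne_zero_iff.2 fun i _ => by positivity
    rw [saalTerm, gaussTerm, real_Gamma_nat_add_eq_prod hj, real_Gamma_nat_add_eq_prod hj',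
      prod_div_distrib, ← add_assoc]
    simp only [add_right_comm _ h] at *
    field_simp
  have hlim : ∑' n, gaussTerm a b e n =
      ∑' n, gaussTerm a b e n * ∏ _i ∈ range n, (1 : ℝ) := by simp
  simp_rw [← tsum_mul_left, hterm]
  rw [hlim]
  refine tendsto_tsum_of_dominated_convergence (summable_gaussTerm ha hb he) (fun n => ?_)
    (Eventually.of_forall fun j n => ?_)
  · refine (tendsto_finsetProd _ fun i _ => ?_).const_mul _
    have h1 : Tendsto (fun j : ℕ => h * (j + (c + i + h))⁻¹) atTop (𝓝 (h * 0)) :=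
      (tendsto_inv_atTop_zero.comp
        (tendsto_atTop_add_const_right _ _ tendsto_natCast_atTop_atTop)).const_mul h
    have h2 := h1.const_sub 1
    rw [mul_zero, sub_zero] at h2
    refine h2.congr fun j => ?_
    have : (j : ℝ) + c + i + h ≠ 0 := by positivity
    rw [← add_assoc, ← add_assoc]
    field_simp
    ring
  · have g := gaussTerm_pos ha hb he' n
    rw [Real.norm_of_nonneg (mul_nonneg g.le (prod_nonneg fun i _ => by positivity))]
    refine mul_le_of_le_one_right g.le (prod_le_one (fun i _ => by positivity) fun i _ => ?_)
    exact div_le_one_of_le₀ (by linarith) (by positivity)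

/-- The difference of the two `₃F₂` series in the nonterminating Saalschütz formula, with the
parameter excess `H` left free. -/
def saalDiff (a b h c H : ℝ) : ℝ :=
  ∑' n, saalTerm a b c (1 + a + b - h) H n -
    ∑' n, saalTerm (h - b) (h - a) (c + h - a - b) (1 + h - a - b) H n

theorem saalDiff_mul_Gamma {a b h c : ℝ} (ha : 0 < a) (hb : 0 < b) (hah : a < h) (hbh : b < h)
    (h1 : h < 1) (hc : 0 < c) (hc' : 0 < c + h - a - b) :
    saalDiff a b h c h * (Real.Gamma (c + h - a) * Real.Gamma (c + h - b)) =
      (∑' n, gaussTerm a b (1 + a + b - h) n -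
        ∑' n, gaussTerm (h - b) (h - a) (1 + h - a - b) n) *
      (Real.Gamma c * Real.Gamma (c + h - a - b)) := by
  have hh : 0 < h := by linarith
  have hconst : ∀ j : ℕ, saalDiff a b h (j + c) h *
      (Real.Gamma (j + (c + h - a)) * Real.Gamma (j + (c + h - b))) /
        (Real.Gamma (j + c) * Real.Gamma (j + (c + h - a - b))) =
      saalDiff a b h c h * (Real.Gamma (c + h - a) * Real.Gamma (c + h - b)) /
        (Real.Gamma c * Real.Gamma (c + h - a - b)) := by
    intro j
    induction j with
    | zero => simp
    | succ j ih =>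
      have hj := j.cast_nonneg (α := ℝ)
      have p1 : 0 < j + c := by linarith
      have p2 : 0 < j + (c + h - a - b) := by linarith
      have g1 := Real.Gamma_pos_of_pos p1
      have g2 := Real.Gamma_pos_of_pos p2
      have st1 := tsum_saalTerm_contiguous ha hb p1 (by linarith : 0 < 1 + a + b - h) hh
        (by ring)
      have st2 := tsum_saalTerm_contiguous (by linarith : 0 < h - b) (by linarith : 0 < h - a)
        p2 (by linarith : 0 < 1 + h - a - b) hh (by ring)
      rw [← ih, real_Gamma_nat_add_succ j (by linarith : (j : ℝ) + (c + h - a) ≠ 0),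
        real_Gamma_nat_add_succ j (by linarith : (j : ℝ) + (c + h - b) ≠ 0),
        real_Gamma_nat_add_succ j p1.ne', real_Gamma_nat_add_succ j p2.ne', Nat.cast_succ,
        add_right_comm (j : ℝ) 1 c, saalDiff, saalDiff,
        show (j : ℝ) + c + 1 + h - a - b = j + (c + h - a - b) + 1 by ring,
        show (j : ℝ) + c + h - a - b = j + (c + h - a - b) by ring]
      generalize ∑' n, saalTerm a b (j + c + 1) (1 + a + b - h) h n = X1 at *
      generalize ∑' n, saalTerm a b (j + c) (1 + a + b - h) h n = X0 at *
      generalize ∑' n, saalTerm (h - b) (h - a) (j + (c + h - a - b) + 1) (1 + h - a - b) h n = Y1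
        at *
      generalize ∑' n, saalTerm (h - b) (h - a) (j + (c + h - a - b)) (1 + h - a - b) h n = Y0
        at *
      rw [div_eq_div_iff (by positivity) (by positivity)]
      linear_combination Real.Gamma (j + (c + h - a)) * Real.Gamma (j + (c + h - b)) *
        Real.Gamma (j + c) * Real.Gamma (j + (c + h - a - b)) * (st1 - st2)
  have l1 := tendsto_Gamma_div_mul_tsum_saalTerm ha hb hc
    (by linarith : a + b < 1 + a + b - h) hh
  have l2 := tendsto_Gamma_div_mul_tsum_saalTerm (by linarith : 0 < h - b)
    (by linarith : 0 < h - a) hc' (by linarith : h - b + (h - a) < 1 + h - a - b) hh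
  have r1 := tendsto_Gamma_quotient_two_one (by linarith : 0 < c + h - a)
    (by linarith : 0 < c + h - b) hc' (by linarith : 0 < c + h) (by ring)
  have r2 := tendsto_Gamma_quotient_two_one (by linarith : 0 < c + h - a)
    (by linarith : 0 < c + h - b) hc (by linarith : 0 < c + h - a - b + h) (by ring)
  have hl := (l1.mul r1).sub (l2.mul r2)
  rw [mul_one, mul_one] at hl
  have hl' := tendsto_nhds_unique (hl.congr fun j => ?_) (tendsto_const_nhds
    (x := saalDiff a b h c h * (Real.Gamma (c + h - a) * Real.Gamma (c + h - b)) /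
        (Real.Gamma c * Real.Gamma (c + h - a - b))))
  · have g1 := Real.Gamma_pos_of_pos hc
    have g2 := Real.Gamma_pos_of_pos hc'
    rw [hl']
    field_simp
  · have hj := j.cast_nonneg (α := ℝ)
    have g1 := Real.Gamma_pos_of_pos (by linarith : 0 < j + c)
    have g2 := Real.Gamma_pos_of_pos (by linarith : 0 < j + (c + h))
    have g3 := Real.Gamma_pos_of_pos (by linarith : 0 < j + (c + h - a - b))
    have g4 := Real.Gamma_pos_of_pos (by linarith : 0 < j + (c + h - a - b + h))
    rw [← hconst j, saalDiff, show (j : ℝ) + c + h - a - b = j + (c + h - a - b) by ring]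
    field_simp

/-- The constant `sin π(h - a - b) Γ(h - a) Γ(h - b) / π` of the nonterminating Saalschütz
formula. -/
def saalConst (a b h : ℝ) : ℝ :=
  Real.sin (Real.pi * (h - a - b)) * Real.Gamma (h - a) * Real.Gamma (h - b) / Real.pi

lemma real_one_div_Gamma_one_sub {x : ℝ} (hx : 0 < x) :
    1 / Real.Gamma (1 - x) = Real.sin (Real.pi * x) * Real.Gamma x / Real.pi := by
  have h := Real.Gamma_mul_Gamma_one_sub x
  have g := Real.Gamma_pos_of_pos hx
  by_cases hs : Real.sin (Real.pi * x) = 0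
  · rw [hs, div_zero] at h
    have h0 : Real.Gamma (1 - x) = 0 := (mul_eq_zero.1 h).resolve_left g.ne'
    simp [hs, h0]
  · have h0 : Real.Gamma (1 - x) ≠ 0 := by
      intro h0
      rw [h0, mul_zero, eq_comm, div_eq_zero_iff] at h
      exact h.elim Real.pi_ne_zero hs
    have := Real.pi_ne_zero
    rw [eq_div_iff hs] at h
    rw [div_eq_div_iff h0 this]
    linarith

lemma tsum_gaussTerm_sub {a b h : ℝ} (ha : 0 < a) (hb : 0 < b) (hah : a < h) (hbh : b < h)
    (h1 : h < 1) :
    Real.Gamma h * (∑' n, gaussTerm a b (1 + a + b - h) n -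
      ∑' n, gaussTerm (h - b) (h - a) (1 + h - a - b) n) =
      saalConst a b h * (Real.Gamma a * Real.Gamma b) := by
  have e1 := real_one_div_Gamma_one_sub (by linarith : 0 < h - a)
  have e2 := real_one_div_Gamma_one_sub (by linarith : 0 < h - b)
  have e3 := real_one_div_Gamma_one_sub ha
  have e4 := real_one_div_Gamma_one_sub hb
  have e5 := real_one_div_Gamma_one_sub (by linarith : 0 < h)
  have g5 := Real.Gamma_pos_of_pos (by linarith : 0 < 1 - h)
  rw [tsum_gaussTerm ha hb (by linarith), tsum_gaussTerm (by linarith) (by linarith)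
    (by linarith), show 1 + a + b - h - a - b = 1 - h by ring,
    show 1 + a + b - h - a = 1 - (h - b) by ring, show 1 + a + b - h - b = 1 - (h - a) by ring,
    show 1 + h - a - b - (h - b) - (h - a) = 1 - h by ring,
    show 1 + h - a - b - (h - b) = 1 - a by ring, show 1 + h - a - b - (h - a) = 1 - b by ring,
    div_eq_mul_one_div, ← one_div_mul_one_div, e1, e2,
    div_eq_mul_one_div (Real.Gamma (h - b) * _ * _), ← one_div_mul_one_div, e3, e4, saalConst]
  have e6 : Real.Gamma h * Real.Gamma (1 - h) * Real.sin (Real.pi * h) = Real.pi := by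
    rw [div_eq_div_iff g5.ne' Real.pi_ne_zero] at e5
    linarith
  have e7 : Real.sin (Real.pi * (h - b)) * Real.sin (Real.pi * (h - a)) -
      Real.sin (Real.pi * a) * Real.sin (Real.pi * b) =
      Real.sin (Real.pi * h) * Real.sin (Real.pi * (h - a - b)) := by
    simp only [mul_sub, Real.sin_sub, Real.cos_sub]
    linear_combination (Real.sin (Real.pi * a) * Real.sin (Real.pi * b)) *
      Real.sin_sq_add_cos_sq (Real.pi * h)
  have hpi := Real.pi_ne_zero
  field_simp
  linear_combination Real.Gamma (h - a) * Real.Gamma (h - b) *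
    (Real.Gamma h * Real.Gamma (1 - h) * e7 + Real.sin (Real.pi * (h - a - b)) * e6)

theorem Gamma_mul_saalDiff {a b h c : ℝ} (ha : 0 < a) (hb : 0 < b) (hah : a < h) (hbh : b < h)
    (h1 : h < 1) (hc : 0 < c) (hc' : 0 < c + h - a - b) :
    Real.Gamma h * saalDiff a b h c h =
      saalConst a b h * (Real.Gamma c * ∑' n, gaussTerm a b (c + h) n) := by
  have e := saalDiff_mul_Gamma ha hb hah hbh h1 hc hc'
  have e' := tsum_gaussTerm_sub ha hb hah hbh h1
  have g1 := Real.Gamma_pos_of_pos (by linarith : 0 < c + h - a)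
  have g2 := Real.Gamma_pos_of_pos (by linarith : 0 < c + h - b)
  rw [tsum_gaussTerm ha hb (by linarith)]
  field_simp
  linear_combination Real.Gamma h * e + Real.Gamma c * Real.Gamma (c + h - a - b) * e'

lemma saalTerm_sub {a b c e h : ℝ} (hc : 0 < c) (hh : 0 < h) (n : ℕ) :
    h * saalTerm a b c e (h + 1) n = saalTerm a b c e h n - saalTerm a b (c + 1) e h n := by
  have h2 : n + (c + h) ≠ 0 := by positivity
  have g2 := Real.Gamma_pos_of_pos (by positivity : 0 < n + (c + h))
  simp only [saalTerm]
  rw [show n + (c + (h + 1)) = n + (c + h) + 1 by ring,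
    show n + (c + 1 + h) = n + (c + h) + 1 by ring, Real.Gamma_add_one h2,
    real_Gamma_add_add_one (by positivity : n + c ≠ 0)]
  generalize Real.Gamma (n + (c + h)) = X at *
  by_cases h3 : Real.Gamma (n + e) = 0
  · simp [h3]
  have h4 : (n ! : ℝ) ≠ 0 := by exact_mod_cast n.factorial_ne_zero
  field_simp
  ring

lemma saalDiff_sub {a b h c H : ℝ} (ha : 0 < a) (hb : 0 < b) (hah : a < h) (hbh : b < h)
    (h1 : h < 1) (hc : 0 < c) (hc' : 0 < c + h - a - b) (hH : h ≤ H) :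
    H * saalDiff a b h c (H + 1) = saalDiff a b h c H - saalDiff a b h (c + 1) H := by
  have hH0 : 0 < H := by linarith
  have s1 := summable_saalTerm ha hb hc (by linarith : 0 < 1 + a + b - h) hH0 (by linarith)
  have s2 := summable_saalTerm ha hb (by linarith : 0 < c + 1)
    (by linarith : 0 < 1 + a + b - h) hH0 (by linarith)
  have s3 := summable_saalTerm (by linarith : 0 < h - b) (by linarith : 0 < h - a) hc'
    (by linarith : 0 < 1 + h - a - b) hH0 (by linarith)
  have s4 := summable_saalTerm (by linarith : 0 < h - b) (by linarith : 0 < h - a)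
    (by linarith : 0 < c + h - a - b + 1) (by linarith : 0 < 1 + h - a - b) hH0 (by linarith)
  rw [saalDiff, saalDiff, saalDiff, show c + 1 + h - a - b = c + h - a - b + 1 by ring, mul_sub,
    ← tsum_mul_left, ← tsum_mul_left]
  simp_rw [saalTerm_sub hc hH0, saalTerm_sub hc' hH0]
  rw [s1.tsum_sub s2, s3.tsum_sub s4]
  ring

/-- The general term of the single series expressing `saalDiff a b h c H`. -/
def saalSumTerm (a b h c H : ℝ) (m : ℕ) : ℝ :=
  Real.Gamma (m + a) * Real.Gamma (m + b) / (m ! * Real.Gamma (m + h)) *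
    (Real.Gamma c * Real.Gamma (m + H) / Real.Gamma (m + (c + H)))

lemma saalSumTerm_sub {a b h c H : ℝ} (hc : 0 < c) (hH : 0 < H) (m : ℕ) :
    saalSumTerm a b h c (H + 1) m = saalSumTerm a b h c H m - saalSumTerm a b h (c + 1) H m := by
  have h2 : m + (c + H) ≠ 0 := by positivity
  have g2 := Real.Gamma_pos_of_pos (by positivity : 0 < m + (c + H))
  simp only [saalSumTerm]
  rw [show m + (c + (H + 1)) = m + (c + H) + 1 by ring,
    show m + (c + 1 + H) = m + (c + H) + 1 by ring, Real.Gamma_add_one h2,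
    real_Gamma_add_add_one (by positivity : m + H ≠ 0), Real.Gamma_add_one hc.ne', ← mul_sub]
  congr 1
  generalize Real.Gamma (m + (c + H)) = X at *
  field_simp
  ring

theorem hasSum_saalSumTerm {a b h c : ℝ} (ha : 0 < a) (hb : 0 < b) (hah : a < h) (hbh : b < h)
    (h1 : h < 1) (hc : 0 < c) (hc' : 0 < c + h - a - b) (n : ℕ) :
    HasSum (fun m => saalConst a b h * saalSumTerm a b h c (n + h) m)
      (Real.Gamma (n + h) * saalDiff a b h c (n + h)) := by
  have hh : 0 < h := by linarith
  induction n generalizing c with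
  | zero =>
    simp only [CharP.cast_eq_zero, zero_add]
    rw [Gamma_mul_saalDiff ha hb hah hbh h1 hc hc']
    refine HasSum.mul_left _ ?_
    refine ((summable_gaussTerm ha hb (by linarith : a + b < c + h)).hasSum.mul_left
      (Real.Gamma c)).congr_fun ?_
    intro m
    have g1 := Real.Gamma_pos_of_pos (by positivity : 0 < m + h)
    simp only [saalSumTerm, gaussTerm]
    field_simp
  | succ n ih =>
    have hn : 0 < n + h := by positivity
    have key := (ih hc hc').sub (ih (by linarith : 0 < c + 1) (by linarith))
    rw [← mul_sub, ← saalDiff_sub ha hb hah hbh h1 hc hc'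
      (by linarith [n.cast_nonneg (α := ℝ)] : h ≤ n + h), ← mul_assoc, mul_comm (Real.Gamma _),
      ← Real.Gamma_add_one hn.ne'] at key
    rw [Nat.cast_succ, add_right_comm]
    refine key.congr_fun fun m => ?_
    rw [saalSumTerm_sub hc hn, mul_sub]

/-! ### The two-term relation in a box of real parameters -/

/-- The general term of a Saalschützian `₄F₃` series with Gamma factors, whose parameters are
`a, b, c, c + h - r - s; e, c + h - s, c + h - r`. -/
def fourTerm (a b c e r s h : ℝ) (k : ℕ) : ℝ :=
  Real.Gamma (k + a) * Real.Gamma (k + b) * Real.Gamma (k + c) * Real.Gamma (k + (c + h - r - s)) /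
    (k ! * Real.Gamma (k + e) * Real.Gamma (k + (c + h - s)) * Real.Gamma (k + (c + h - r)))

lemma summable_fourTerm {a b c e r s h : ℝ} (ha : 0 < a) (hb : 0 < b) (hc : 0 < c) (he : 0 < e)
    (hr : 0 < r) (hs : 0 < s) (hd : 0 < c + h - r - s) (H : a + b < e + h) :
    Summable (fourTerm a b c e r s h) := by
  rw [← summable_nat_add_iff 1]
  have h' := tendsto_rpow_mul_prod_Gamma_div ![a, b, c, c + h - r - s] ![1, e, c + h - s, c + h - r]
    (by simp only [Fin.forall_fin_succ]; simp [ha, hb, hc, hd])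
    (by simp only [Fin.forall_fin_succ]; simp [he]; constructor <;> linarith)
  simp only [Fin.sum_univ_four, Fin.prod_univ_four, Matrix.cons_val_zero, Matrix.cons_val_one,
    Matrix.cons_val] at h'
  refine summable_of_tendsto_rpow_mul
    (p := 1 + e + (c + h - s) + (c + h - r) - (a + b + c + (c + h - r - s))) (by linarith)
    (h'.congr fun n => ?_)
  rw [fourTerm, ← Real.Gamma_nat_eq_factorial, div_mul_div_comm, div_mul_div_comm,
    div_mul_div_comm]
  push_cast
  have e : ∀ x : ℝ, x + n + 1 = n + 1 + x := fun x => by ring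
  simp only [e]

lemma hasSum_saalTerm_fourTerm {a b c e r s h : ℝ}
    (hr : 0 < r) (hs : 0 < s) (hd : 0 < c + h - r - s) (k : ℕ) :
    HasSum (fun n : ℕ => Real.Gamma (n + r) * Real.Gamma (n + s) / n ! * saalTerm a b c e (n + h) k)
      (Real.Gamma r * Real.Gamma s * fourTerm a b c e r s h k) := by
  have hk := k.cast_nonneg (α := ℝ)
  have hsum := (summable_gaussTerm hr hs (by linarith : r + s < k + (c + h))).hasSum.mul_left
    (Real.Gamma (k + a) * Real.Gamma (k + b) * Real.Gamma (k + c) / (k ! * Real.Gamma (k + e)))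
  rw [tsum_gaussTerm hr hs (by linarith)] at hsum
  convert! hsum using 1
  · funext n
    rw [saalTerm, gaussTerm, show (k : ℝ) + (c + (n + h)) = n + (k + (c + h)) by ring]
    ring
  · rw [fourTerm, show (k : ℝ) + (c + h) - r - s = k + (c + h - r - s) by ring,
      show (k : ℝ) + (c + h) - r = k + (c + h - r) by ring,
      show (k : ℝ) + (c + h) - s = k + (c + h - s) by ring]
    ring

lemma hasSum_tsum_saalTerm {a b c e r s h : ℝ} (ha : 0 < a) (hb : 0 < b) (hc : 0 < c) (he : 0 < e)
    (hr : 0 < r) (hs : 0 < s) (hh : 0 < h) (hd : 0 < c + h - r - s) (H : a + b < e + h) :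
    HasSum (fun n : ℕ => Real.Gamma (n + r) * Real.Gamma (n + s) / n ! *
        ∑' k, saalTerm a b c e (n + h) k)
      (Real.Gamma r * Real.Gamma s * ∑' k, fourTerm a b c e r s h k) := by
  let T : ℕ × ℕ → ℝ := fun p => Real.Gamma (p.2 + r) * Real.Gamma (p.2 + s) / p.2 ! *
    saalTerm a b c e (p.2 + h) p.1
  have hT0 : 0 ≤ T := fun p => by
    have g1 := Real.Gamma_pos_of_pos (by positivity : 0 < p.2 + r)
    have g2 := Real.Gamma_pos_of_pos (by positivity : 0 < p.2 + s)
    have := saalTerm_pos ha hb hc he (by positivity : 0 < p.2 + h) p.1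
    positivity
  have hrow := fun k => hasSum_saalTerm_fourTerm (a := a) (b := b) (e := e) hr hs hd k
  have hT : Summable T := by
    refine (summable_prod_of_nonneg hT0).2 ⟨fun k => (hrow k).summable, ?_⟩
    exact ((summable_fourTerm ha hb hc he hr hs hd H).mul_left _).congr fun k =>
      ((hrow k).tsum_eq).symm
  have hswap := hT.prod_symm
  have hfib := hswap.hasSum.prod_fiberwise fun n => (hswap.prod_factor n).hasSum
  convert! hfib using 1
  · funext n
    rw [← tsum_mul_left]
    rfl
  · have hcomm : ∑' p : ℕ × ℕ, T p.swap = ∑' p, T p := (Equiv.prodComm ℕ ℕ).tsum_eq T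
    rw [← tsum_mul_left, hcomm, hT.tsum_prod]
    exact tsum_congr fun k => ((hrow k).tsum_eq).symm

/-- The difference of two Saalschützian `₄F₃` series occurring in the function `L`. -/
def fourDiff (a b r s h c : ℝ) : ℝ :=
  ∑' k, fourTerm a b c (1 + a + b - h) r s h k -
    ∑' k, fourTerm (h - b) (h - a) (c + h - a - b) (1 + h - a - b) r s h k

/-- The general term of the symmetric double series expressing `fourDiff`. -/
def doubleTerm (a b r s h c : ℝ) (p : ℕ × ℕ) : ℝ :=
  Real.Gamma (p.1 + a) * Real.Gamma (p.1 + b) / (p.1 ! * Real.Gamma (p.1 + h)) *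
    (Real.Gamma (p.2 + r) * Real.Gamma (p.2 + s) / (p.2 ! * Real.Gamma (p.2 + h))) *
    (Real.Gamma c * Real.Gamma (p.1 + p.2 + h) / Real.Gamma (p.1 + p.2 + h + c))

lemma doubleTerm_swap (a b r s h c : ℝ) (p : ℕ × ℕ) :
    doubleTerm a b r s h c p.swap = doubleTerm r s a b h c p := by
  simp only [doubleTerm, Prod.fst_swap, Prod.snd_swap]
  rw [add_comm (p.2 : ℝ) p.1]
  ring

theorem Gamma_mul_fourDiff {a b r s h c : ℝ} (ha : 0 < a) (hb : 0 < b) (hr : 0 < r) (hs : 0 < s)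
    (hab : a + b < h) (h1 : h < 1) (hc : 0 < c) (hd : 0 < c + h - r - s)
    (hd' : 0 < c + h - a - b + h - r - s) :
    Real.Gamma r * Real.Gamma s * fourDiff a b r s h c =
      saalConst a b h * ∑' p, doubleTerm a b r s h c p := by
  have hh : 0 < h := by linarith
  have hc' : 0 < c + h - a - b := by linarith
  have hκ : 0 < saalConst a b h := by
    have g1 := Real.Gamma_pos_of_pos (by linarith : 0 < h - a)
    have g2 := Real.Gamma_pos_of_pos (by linarith : 0 < h - b)
    have g3 : 0 < Real.sin (Real.pi * (h - a - b)) := Real.sin_pos_of_pos_of_lt_pi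
      (mul_pos Real.pi_pos (by linarith)) (mul_lt_of_lt_one_right Real.pi_pos (by linarith))
    have := Real.pi_pos
    rw [saalConst]
    positivity
  have hF := (hasSum_tsum_saalTerm ha hb hc (by linarith : 0 < 1 + a + b - h) hr hs hh hd
    (by linarith)).sub (hasSum_tsum_saalTerm (by linarith : 0 < h - b) (by linarith : 0 < h - a) hc'
      (by linarith : 0 < 1 + h - a - b) hr hs hh hd' (by linarith))
  have hrow : ∀ n : ℕ, HasSum (fun m : ℕ => saalConst a b h * doubleTerm a b r s h c (m, n))
      (Real.Gamma (n + r) * Real.Gamma (n + s) / n ! * saalDiff a b h c (n + h)) := by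
    intro n
    have g := Real.Gamma_pos_of_pos (by positivity : 0 < n + h)
    have h2 := (hasSum_saalSumTerm ha hb (by linarith) (by linarith) h1 hc hc' n).mul_left
      (Real.Gamma (n + r) * Real.Gamma (n + s) / (n ! * Real.Gamma (n + h)))
    convert! h2 using 1
    · funext m
      simp only [doubleTerm, saalSumTerm]
      rw [show (m : ℝ) + (c + (n + h)) = m + n + h + c by ring, ← add_assoc (m : ℝ) n h]
      ring
    · field_simp
  have hT0 : 0 ≤ fun p : ℕ × ℕ => saalConst a b h * doubleTerm a b r s h c p.swap := fun p => by
    have g1 := Real.Gamma_pos_of_pos (by positivity : 0 < p.2 + a)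
    have g2 := Real.Gamma_pos_of_pos (by positivity : 0 < p.2 + b)
    have g3 := Real.Gamma_pos_of_pos (by positivity : 0 < p.1 + r)
    have g4 := Real.Gamma_pos_of_pos (by positivity : 0 < p.1 + s)
    have g5 := Real.Gamma_pos_of_pos (by positivity : 0 < p.1 + h)
    have g6 := Real.Gamma_pos_of_pos (by positivity : 0 < p.2 + h)
    have g7 := Real.Gamma_pos_of_pos (by positivity : 0 < (p.2 : ℝ) + p.1 + h)
    have g8 := Real.Gamma_pos_of_pos (by positivity : 0 < (p.2 : ℝ) + p.1 + h + c)
    have g9 := Real.Gamma_pos_of_pos hc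
    simp only [doubleTerm, Prod.fst_swap, Prod.snd_swap, Pi.zero_apply]
    positivity
  simp_rw [← mul_sub] at hF
  have hT : Summable fun p : ℕ × ℕ => saalConst a b h * doubleTerm a b r s h c p.swap := by
    refine (summable_prod_of_nonneg hT0).2 ⟨fun n => (hrow n).summable, ?_⟩
    exact hF.summable.congr fun n => ((hrow n).tsum_eq).symm
  rw [← tsum_mul_left, ← (Equiv.prodComm ℕ ℕ).tsum_eq, fourDiff, ← hF.tsum_eq]
  refine Eq.trans ?_ hT.tsum_prod.symm
  exact tsum_congr fun n => ((hrow n).tsum_eq).symm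

theorem fourDiff_symm {a b r s h c : ℝ} (ha : 0 < a) (hb : 0 < b) (hr : 0 < r) (hs : 0 < s)
    (hab : a + b < h) (hrs : r + s < h) (h1 : h < 1) (hc : 0 < c)
    (hd : 0 < c + h - a - b + h - r - s) :
    saalConst r s h * (Real.Gamma r * Real.Gamma s * fourDiff a b r s h c) =
      saalConst a b h * (Real.Gamma a * Real.Gamma b * fourDiff r s a b h c) := by
  rw [Gamma_mul_fourDiff ha hb hr hs hab h1 hc (by linarith) hd,
    Gamma_mul_fourDiff hr hs ha hb hrs h1 hc (by linarith) (by linarith),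
    ← (Equiv.prodComm ℕ ℕ).tsum_eq]
  simp only [Equiv.prodComm_apply, doubleTerm_swap]
  ring

/-! ### Periodic entire functions of small exponential type -/

open Function.Periodic in
lemma exists_sub_exp_isBigO_one {f : ℂ → ℂ} (hf : Differentiable ℂ f) (hp : ∀ z, f (z + 1) = f z)
    (h0 : Tendsto (fun z => f z * cexp (4 * Real.pi * I * z)) (comap Complex.im atTop) (𝓝 0)) :
    ∃ A : ℂ, (fun z => f z - A * cexp (-(2 * Real.pi * I * z))) =O[comap Complex.im atTop]
      (fun _ => (1 : ℝ)) := by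
  have hper : ∀ n : ℤ, Function.Periodic (fun z => f z * cexp (2 * n * Real.pi * I * z))
      ((1 : ℝ) : ℂ) := fun n z => by
    simp only [ofReal_one, hp]
    rw [mul_add, mul_one, Complex.exp_add, show 2 * (n : ℂ) * Real.pi * I = n * (2 * Real.pi * I)
      by ring, Complex.exp_int_mul_two_pi_mul_I, mul_one]
  have hdiff : ∀ c : ℂ, Differentiable ℂ (fun z => f z * cexp (c * z)) := fun c => by fun_prop
  have hnorm : ∀ (c : ℝ) (z : ℂ), ‖cexp (2 * c * Real.pi * I * z)‖ =
      Real.exp (-2 * c * Real.pi * z.im) := fun c z => by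
    rw [Complex.norm_exp]
    simp
  have h1 : (fun z => f z * cexp (2 * (2 : ℤ) * Real.pi * I * z)) =O[comap Complex.im atTop]
      fun z => Real.exp (-2 * Real.pi * z.im / 1) := by
    refine exp_decay_of_zero_at_inf one_pos (hper 2) (Eventually.of_forall fun z => (hdiff _) z) ?_
    refine h0.congr fun z => ?_
    push_cast
    ring_nf
  have h2 : (fun z => f z * cexp (2 * (1 : ℤ) * Real.pi * I * z)) =O[comap Complex.im atTop]
      fun _ => (1 : ℝ) := by
    have h3 := h1.mul (Asymptotics.isBigO_refl
      (fun z => cexp (2 * ((-1 : ℝ) : ℂ) * Real.pi * I * z)) (comap Complex.im atTop)).norm_right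
    refine (h3.congr_left fun z => ?_).congr_right fun z => ?_
    · rw [mul_assoc, ← Complex.exp_add]
      congr 2
      push_cast
      ring
    · rw [hnorm, ← Real.exp_add, Real.exp_eq_one_iff]
      ring
  obtain ⟨A, h4⟩ : ∃ A : ℂ, (fun z => f z * cexp (2 * (1 : ℤ) * Real.pi * I * z) - A)
      =O[comap Complex.im atTop] fun z => Real.exp (-2 * Real.pi * z.im / 1) :=
    ⟨_, exp_decay_sub_of_bounded_at_inf one_pos (hper 1)
      (Eventually.of_forall fun z => (hdiff _) z) h2⟩
  refine ⟨A, ?_⟩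
  have h5 := h4.mul (Asymptotics.isBigO_refl
    (fun z => cexp (2 * ((-1 : ℝ) : ℂ) * Real.pi * I * z)) (comap Complex.im atTop)).norm_right
  refine (h5.congr_left fun z => ?_).congr_right fun z => ?_
  · rw [sub_mul, mul_assoc, ← Complex.exp_add, show 2 * ((1 : ℤ) : ℂ) * Real.pi * I * z +
      2 * ((-1 : ℝ) : ℂ) * Real.pi * I * z = 0 by push_cast; ring, Complex.exp_zero, mul_one]
    congr 3
    push_cast
    ring
  · rw [hnorm, ← Real.exp_add, Real.exp_eq_one_iff]
    ring

lemma bounded_of_periodic_of_bounded {g : ℂ → ℂ} (hg : Continuous g) (hp : ∀ z, g (z + 1) = g z)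
    {R C : ℝ} (h : ∀ z : ℂ, R ≤ |z.im| → ‖g z‖ ≤ C) : Bornology.IsBounded (Set.range g) := by
  obtain ⟨K, hK⟩ := ((isCompact_Icc (a := (0 : ℝ)) (b := 1)).reProdIm
    (isCompact_Icc (a := -R) (b := R))).exists_bound_of_continuousOn hg.continuousOn
  refine isBounded_iff_forall_norm_le.2 ⟨max K C, ?_⟩
  rintro _ ⟨z, rfl⟩
  have hper : Function.Periodic g 1 := hp
  by_cases hz : R ≤ |z.im|
  · exact (h z hz).trans (le_max_right _ _)
  · have h1 : g (z - ⌊z.re⌋) = g z := by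
      simpa using hper.sub_int_mul_eq ⌊z.re⌋ (x := z)
    rw [← h1]
    refine (hK _ ?_).trans (le_max_left _ _)
    rw [Complex.mem_reProdIm]
    have h2 := abs_le.1 (not_le.1 hz).le
    constructor
    · simpa using (Int.fract_lt_one z.re).le
    · simpa using h2

theorem exists_eq_trigonometric {f : ℂ → ℂ} (hf : Differentiable ℂ f) (hp : ∀ z, f (z + 1) = f z)
    (h0 : Tendsto (fun z => f z * cexp (4 * Real.pi * I * z)) (comap Complex.im atTop) (𝓝 0))
    (h1 : Tendsto (fun z => f (-z) * cexp (4 * Real.pi * I * z)) (comap Complex.im atTop) (𝓝 0)) :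
    ∃ A B C : ℂ, ∀ z, f z = C + A * cexp (-(2 * Real.pi * I * z)) +
      B * cexp (2 * Real.pi * I * z) := by
  obtain ⟨A, hA⟩ := exists_sub_exp_isBigO_one hf hp h0
  obtain ⟨B, hB⟩ := exists_sub_exp_isBigO_one (f := fun z => f (-z)) (hf.comp differentiable_neg)
    (fun z => by rw [← hp (-(z + 1))]; congr 1; ring) h1
  obtain ⟨K, hA⟩ := hA.bound
  obtain ⟨K', hB⟩ := hB.bound
  obtain ⟨R, hA⟩ := (eventually_atTop.1 (eventually_comap.1 hA))
  obtain ⟨R', hB⟩ := (eventually_atTop.1 (eventually_comap.1 hB))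
  have hnorm : ∀ z : ℂ, 0 ≤ z.im → ‖cexp (2 * Real.pi * I * z)‖ ≤ 1 := fun z hz => by
    rw [Complex.norm_exp, Real.exp_le_one_iff]
    simp only [mul_re, mul_im, re_ofNat, im_ofNat, ofReal_re, ofReal_im, I_re, I_im]
    nlinarith [Real.pi_pos]
  let g : ℂ → ℂ := fun z => f z - A * cexp (-(2 * Real.pi * I * z)) - B * cexp (2 * Real.pi * I * z)
  have hgd : Differentiable ℂ g := by fun_prop
  have hexp : ∀ z : ℂ, cexp (2 * Real.pi * I * (z + 1)) = cexp (2 * Real.pi * I * z) := fun z => by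
    rw [mul_add, mul_one, Complex.exp_add, Complex.exp_two_pi_mul_I, mul_one]
  have hgp : ∀ z, g (z + 1) = g z := fun z => by
    simp only [g, hp, Complex.exp_neg, hexp]
  have hbd : ∀ z : ℂ, max (max R R') 0 ≤ |z.im| → ‖g z‖ ≤ max (K + ‖B‖) (K' + ‖A‖) := by
    intro z hz
    rcases le_total 0 z.im with him | him
    · rw [abs_of_nonneg him] at hz
      have e1 := hA z.im ((le_max_left _ _).trans ((le_max_left _ _).trans hz)) z rfl
      have e2 := mul_le_mul_of_nonneg_left (hnorm z him) (norm_nonneg B)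
      rw [norm_one, mul_one] at e1
      rw [← norm_mul, mul_one] at e2
      exact ((norm_sub_le _ _).trans (add_le_add e1 e2)).trans (le_max_left _ _)
    · rw [abs_of_nonpos him] at hz
      have e1 := hB (-z).im ((le_max_right _ _).trans ((le_max_left _ _).trans hz)) (-z) rfl
      have e2 := mul_le_mul_of_nonneg_left (hnorm (-z) (by simpa using him)) (norm_nonneg A)
      rw [norm_one, mul_one] at e1
      rw [← norm_mul, mul_one] at e2
      have e3 : g z = (f (- -z) - B * cexp (-(2 * Real.pi * I * -z))) -
          A * cexp (2 * Real.pi * I * -z) := by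
        simp only [g, neg_neg, mul_neg]
        ring
      rw [e3]
      exact ((norm_sub_le _ _).trans (add_le_add e1 e2)).trans (le_max_right _ _)
  obtain ⟨C, hC⟩ := hgd.exists_const_forall_eq_of_bounded
    (bounded_of_periodic_of_bounded hgd.continuous hgp hbd)
  refine ⟨A, B, C, fun z => ?_⟩
  rw [← hC z]
  simp only [g]
  ring

/-! ### Bilateral series of reciprocal Gamma products -/

/-- The entire function `∏ᵢ 1 / (Γ(1 - aᵢ) Γ(eᵢ))`. -/
def gammaKernel (a e : Fin 4 → ℂ) : ℂ := ∏ i, (Gamma (1 - a i))⁻¹ * (Gamma (e i))⁻¹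

/-- The bilateral series `∑ₙ ∏ᵢ 1 / (Γ(1 - aᵢ - n) Γ(eᵢ + n))`. -/
def bilateralSum (a e : Fin 4 → ℂ) : ℂ :=
  ∑' n : ℤ, gammaKernel (fun i => a i + n) (fun i => e i + n)

lemma gammaKernel_add_one_mul (a e : Fin 4 → ℂ) :
    gammaKernel (fun i => a i + 1) (fun i => e i + 1) * ∏ i, e i =
      gammaKernel a e * ∏ i, a i := by
  have hneg : ∏ i, a i = ∏ i, -a i := by simp [Fin.prod_univ_four]
  rw [hneg]
  simp only [gammaKernel, ← prod_mul_distrib]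
  refine prod_congr rfl fun i _ => ?_
  have h1 := Complex.one_div_Gamma_eq_self_mul_one_div_Gamma_add_one (e i)
  have h2 := Complex.one_div_Gamma_eq_self_mul_one_div_Gamma_add_one (1 - (a i + 1))
  rw [show 1 - (a i + 1) + 1 = 1 - a i by ring] at h2
  rw [h1, h2]
  ring

lemma gammaKernel_reflect (a e : Fin 4 → ℂ) :
    gammaKernel (fun i => 1 - e i) (fun i => 1 - a i) = gammaKernel a e := by
  simp only [gammaKernel, sub_sub_cancel]
  exact prod_congr rfl fun i _ => mul_comm _ _

lemma differentiable_gammaKernel {E : Type*} [NormedAddCommGroup E] [NormedSpace ℂ E]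
    {a e : Fin 4 → E → ℂ} (ha : ∀ i, Differentiable ℂ (a i)) (he : ∀ i, Differentiable ℂ (e i)) :
    Differentiable ℂ fun t => gammaKernel (fun i => a i t) (fun i => e i t) := by
  have hinv : ∀ f : E → ℂ, Differentiable ℂ f → Differentiable ℂ fun t => (Gamma (f t))⁻¹ :=
    fun f hf => differentiable_one_div_Gamma.comp hf
  have ha' : ∀ i, Differentiable ℂ fun t => (Gamma (1 - a i t))⁻¹ :=
    fun i => hinv _ ((differentiable_const _).sub (ha i))
  have he' : ∀ i, Differentiable ℂ fun t => (Gamma (e i t))⁻¹ := fun i => hinv _ (he i)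
  unfold gammaKernel
  simp only [Fin.prod_univ_four]
  exact ((((ha' 0).mul (he' 0)).mul ((ha' 1).mul (he' 1))).mul
    ((ha' 2).mul (he' 2))).mul ((ha' 3).mul (he' 3))

lemma exists_norm_prod_one_add_sub_le (k : ℕ) (B : ℝ) : ∃ K : ℝ, 0 ≤ K ∧ ∀ x : Fin k → ℂ,
    (∀ i, ‖x i‖ ≤ B) → ∀ u : ℂ, ‖u‖ ≤ 1 → ‖∏ i, (1 + u * x i) - 1 - u * ∑ i, x i‖ ≤ K * ‖u‖ ^ 2 := by
  induction k with
  | zero => exact ⟨0, le_rfl, fun x _ u _ => by simp⟩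
  | succ k ih =>
    obtain ⟨K, hK, h⟩ := ih
    refine ⟨(1 + |B|) * K + k * |B| * |B|, by positivity, fun x hx u hu => ?_⟩
    have h1 := h (fun i => x i.succ) (fun i => hx _) u hu
    rw [Fin.prod_univ_succ, Fin.sum_univ_succ]
    set P := ∏ i : Fin k, (1 + u * x i.succ)
    set S := ∑ i : Fin k, x i.succ with hS
    have hx0 : ‖x 0‖ ≤ |B| := (hx 0).trans (le_abs_self B)
    have hS' : ‖S‖ ≤ k * |B| := by
      refine (norm_sum_le_of_le _ fun i _ => (hx i.succ).trans (le_abs_self B)).trans ?_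
      simp
    have h2 : (1 + u * x 0) * P - 1 - u * (x 0 + S) =
      (1 + u * x 0) * (P - 1 - u * S) + u ^ 2 * (x 0 * S) := by ring
    have h3 : ‖1 + u * x 0‖ ≤ 1 + |B| := by
      refine (norm_add_le _ _).trans ?_
      rw [norm_one, norm_mul]
      have := mul_le_mul hu hx0 (norm_nonneg _) zero_le_one
      linarith
    rw [h2]
    calc _ ≤ _ := norm_add_le _ _
      _ = ‖1 + u * x 0‖ * ‖P - 1 - u * S‖ + ‖u‖ ^ 2 * (‖x 0‖ * ‖S‖) := by simp
      _ ≤ (1 + |B|) * (K * ‖u‖ ^ 2) + ‖u‖ ^ 2 * (|B| * (k * |B|)) := by gcongr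
      _ = _ := by ring

lemma exists_norm_prod_add_le (k : ℕ) (B : ℝ) : ∃ M R : ℝ, 0 ≤ M ∧ 1 ≤ R ∧ ∀ x y : Fin k → ℂ,
    (∀ i, ‖x i‖ ≤ B) → (∀ i, ‖y i‖ ≤ B) → ∑ i, x i = ∑ i, y i → ∀ s : ℂ, R ≤ ‖s‖ →
      ∏ i, (s + y i) ≠ 0 ∧
        ‖∏ i, (s + x i)‖ ≤ (1 + M / ‖s‖ ^ 2) * ‖∏ i, (s + y i)‖ := by
  obtain ⟨K, hK, h⟩ := exists_norm_prod_one_add_sub_le k B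
  refine ⟨2 ^ k * (2 * K), max 1 (2 * B), by positivity, le_max_left _ _,
    fun x y hx hy hxy s hs => ?_⟩
  have hs1 : 1 ≤ ‖s‖ := (le_max_left _ _).trans hs
  have hs2 : 2 * B ≤ ‖s‖ := (le_max_right _ _).trans hs
  have hs0 : s ≠ 0 := norm_pos_iff.1 (by linarith)
  have hu : ‖s⁻¹‖ ≤ 1 := by rw [norm_inv]; exact inv_le_one_of_one_le₀ hs1
  have hfac : ∀ z : Fin k → ℂ, ∏ i, (s + z i) = s ^ k * ∏ i, (1 + s⁻¹ * z i) := fun z => by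
    rw [← Fin.prod_const k s, ← prod_mul_distrib]
    exact prod_congr rfl fun i _ => by field_simp
  have hlow : (1 / 2 : ℝ) ^ k ≤ ‖∏ i, (1 + s⁻¹ * y i)‖ := by
    rw [norm_prod, ← Fin.prod_const k (1 / 2 : ℝ)]
    refine prod_le_prod (fun _ _ => by norm_num) fun i _ => ?_
    have h1 : ‖s⁻¹ * y i‖ ≤ 1 / 2 := by
      rw [norm_mul, norm_inv, inv_mul_le_iff₀ (by linarith)]
      linarith [hy i]
    have h2 := norm_sub_le (1 + s⁻¹ * y i) (s⁻¹ * y i)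
    rw [add_sub_cancel_right, norm_one] at h2
    linarith
  have hd : ‖∏ i, (1 + s⁻¹ * x i) - ∏ i, (1 + s⁻¹ * y i)‖ ≤ 2 * K * ‖s⁻¹‖ ^ 2 := by
    have h1 := norm_sub_le_of_le (h x hx _ hu) (h y hy _ hu)
    rw [hxy] at h1
    calc _ = _ := by congr 1; ring
      _ ≤ _ := h1
      _ = _ := by ring
  rw [hfac, hfac]
  refine ⟨mul_ne_zero (pow_ne_zero _ hs0) (norm_pos_iff.1 (lt_of_lt_of_le (by positivity) hlow)), ?_⟩
  rw [norm_mul, norm_mul, mul_left_comm]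
  refine mul_le_mul_of_nonneg_left ?_ (norm_nonneg _)
  have h3 : ‖∏ i, (1 + s⁻¹ * x i)‖ ≤ ‖∏ i, (1 + s⁻¹ * y i)‖ +
      ‖∏ i, (1 + s⁻¹ * x i) - ∏ i, (1 + s⁻¹ * y i)‖ := by
    simpa using norm_add_le (∏ i, (1 + s⁻¹ * y i))
      (∏ i, (1 + s⁻¹ * x i) - ∏ i, (1 + s⁻¹ * y i))
  have h4 : 1 ≤ 2 ^ k * ‖∏ i, (1 + s⁻¹ * y i)‖ := by
    have := mul_le_mul_of_nonneg_left hlow (by positivity : (0 : ℝ) ≤ 2 ^ k)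
    rwa [← mul_pow, show (2 : ℝ) * (1 / 2) = 1 by norm_num, one_pow] at this
  have h5 := mul_le_mul_of_nonneg_left h4 (by positivity : (0 : ℝ) ≤ 2 * K * ‖s⁻¹‖ ^ 2)
  rw [mul_one] at h5
  calc _ ≤ _ := h3
    _ ≤ ‖∏ i, (1 + s⁻¹ * y i)‖ + 2 * K * ‖s⁻¹‖ ^ 2 * (2 ^ k * ‖∏ i, (1 + s⁻¹ * y i)‖) := by
      linarith
    _ = _ := by
      rw [norm_inv]
      field_simp

/-- The kernel along a line, normalised to have a limit at `+∞`. -/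
def scaledKernel (a e : Fin 4 → ℂ) (s : ℂ) : ℂ :=
  s ^ 2 * gammaKernel (fun i => a i + s) (fun i => e i + s)

lemma scaledKernel_add_one_mul (a e : Fin 4 → ℂ) (s : ℂ) :
    scaledKernel a e (s + 1) * ∏ i, (s + (Fin.cons 0 (Fin.cons 0 e) : Fin 6 → ℂ) i) =
      scaledKernel a e s * ∏ i, (s + (Fin.cons 1 (Fin.cons 1 a) : Fin 6 → ℂ) i) := by
  have h := gammaKernel_add_one_mul (fun i => a i + s) (fun i => e i + s)
  simp only [add_assoc] at h
  rw [Fin.prod_univ_succ, Fin.prod_univ_succ, Fin.prod_univ_succ (n := 5),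
    Fin.prod_univ_succ (n := 4)]
  simp only [Fin.cons_zero, Fin.cons_succ, scaledKernel, add_comm s (e _), add_comm s (a _)]
  linear_combination (s + 1) ^ 2 * s ^ 2 * h

lemma exists_norm_scaledKernel_add_one_le (B : ℝ) : ∃ M R : ℝ, 0 ≤ M ∧ 1 ≤ R ∧
    ∀ a e : Fin 4 → ℂ, (∀ i, ‖a i‖ ≤ B) → (∀ i, ‖e i‖ ≤ B) → ∑ i, e i - ∑ i, a i = 2 →
      ∀ s : ℂ, R ≤ ‖s‖ →
        ‖scaledKernel a e (s + 1)‖ ≤ (1 + M / ‖s‖ ^ 2) * ‖scaledKernel a e s‖ ∧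
        ‖scaledKernel a e s‖ ≤ (1 + M / ‖s‖ ^ 2) * ‖scaledKernel a e (s + 1)‖ := by
  obtain ⟨M, R, hM, hR, h⟩ := exists_norm_prod_add_le 6 (max 1 B)
  refine ⟨M, R, hM, hR, fun a e ha he hae s hs => ?_⟩
  have hrec := congrArg norm (scaledKernel_add_one_mul a e s)
  rw [norm_mul, norm_mul] at hrec
  have hX : ∀ i, ‖(Fin.cons 1 (Fin.cons 1 a) : Fin 6 → ℂ) i‖ ≤ max 1 B := by
    refine Fin.cases (by simp) (Fin.cases (by simp) fun i => ?_)
    simpa using Or.inr (ha i)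
  have hY : ∀ i, ‖(Fin.cons 0 (Fin.cons 0 e) : Fin 6 → ℂ) i‖ ≤ max 1 B := by
    refine Fin.cases (by simp) (Fin.cases (by simp) fun i => ?_)
    simpa using Or.inr (he i)
  have hXY : ∑ i, (Fin.cons 1 (Fin.cons 1 a) : Fin 6 → ℂ) i =
      ∑ i, (Fin.cons 0 (Fin.cons 0 e) : Fin 6 → ℂ) i := by
    rw [Fin.sum_cons, Fin.sum_cons, Fin.sum_cons, Fin.sum_cons]
    linear_combination -hae
  obtain ⟨hY0, h1⟩ := h _ _ hX hY hXY s hs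
  obtain ⟨hX0, h2⟩ := h _ _ hY hX hXY.symm s hs
  set X := ∏ i, (s + (Fin.cons 1 (Fin.cons 1 a) : Fin 6 → ℂ) i)
  set Y := ∏ i, (s + (Fin.cons 0 (Fin.cons 0 e) : Fin 6 → ℂ) i)
  constructor
  · refine le_of_mul_le_mul_right ?_ (norm_pos_iff.2 hY0)
    rw [hrec, mul_right_comm, mul_comm]
    exact mul_le_mul_of_nonneg_right h1 (norm_nonneg _)
  · refine le_of_mul_le_mul_right ?_ (norm_pos_iff.2 hX0)
    rw [← hrec, mul_right_comm, mul_comm]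
    exact mul_le_mul_of_nonneg_right h2 (norm_nonneg _)

lemma norm_le_exp_sum_mul {v : ℕ → ℂ} {c : ℕ → ℝ} {E : ℝ}
    (hE : ∀ n, ∑ j ∈ range n, c j ≤ E) (h : ∀ j, ‖v (j + 1)‖ ≤ (1 + c j) * ‖v j‖) (n : ℕ) :
    ‖v n‖ ≤ Real.exp E * ‖v 0‖ := by
  have h1 : ‖v n‖ ≤ Real.exp (∑ j ∈ range n, c j) * ‖v 0‖ := by
    induction n with
    | zero => simp
    | succ n ih =>
      rw [sum_range_succ, Real.exp_add]
      calc _ ≤ _ := h n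
        _ ≤ Real.exp (c n) * (Real.exp (∑ j ∈ range n, c j) * ‖v 0‖) := by
          gcongr
          rw [add_comm]
          exact Real.add_one_le_exp _
        _ = _ := by ring
  exact h1.trans (by gcongr; exact hE n)

lemma norm_zero_le_exp_sum_mul {v : ℕ → ℂ} {c : ℕ → ℝ} {E : ℝ}
    (hE : ∀ n, ∑ j ∈ range n, c j ≤ E) (h : ∀ j, ‖v j‖ ≤ (1 + c j) * ‖v (j + 1)‖) (n : ℕ) :
    ‖v 0‖ ≤ Real.exp E * ‖v n‖ := by
  have h1 : ‖v 0‖ ≤ Real.exp (∑ j ∈ range n, c j) * ‖v n‖ := by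
    induction n with
    | zero => simp
    | succ n ih =>
      rw [sum_range_succ, Real.exp_add]
      calc _ ≤ _ := ih
        _ ≤ Real.exp (∑ j ∈ range n, c j) * (Real.exp (c n) * ‖v (n + 1)‖) := by
          gcongr
          refine (h n).trans ?_
          gcongr
          rw [add_comm]
          exact Real.add_one_le_exp _
        _ = _ := by ring
  exact h1.trans (by gcongr; exact hE n)

lemma summable_inv_add_one_sq : Summable fun j : ℕ => 1 / ((j : ℝ) + 1) ^ 2 := by
  simpa using (summable_nat_add_iff 1).2 (Real.summable_one_div_nat_pow.2 one_lt_two)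

lemma exists_norm_gammaKernel_nat_le (B : ℝ) : ∃ C : ℝ, 0 ≤ C ∧ ∀ a e : Fin 4 → ℂ,
    (∀ i, ‖a i‖ ≤ B) → (∀ i, ‖e i‖ ≤ B) → ∑ i, e i - ∑ i, a i = 2 → ∀ n : ℕ,
      ‖gammaKernel (fun i => a i + n) (fun i => e i + n)‖ ≤ C * (1 / ((n : ℝ) + 1) ^ 2) := by
  obtain ⟨M, R, hM, hR, h⟩ := exists_norm_scaledKernel_add_one_le B
  obtain ⟨N, hN⟩ := exists_nat_ge R
  have hcpt : ∀ n : ℕ, ∃ C : ℝ, 0 ≤ C ∧ ∀ a e : Fin 4 → ℂ, (∀ i, ‖a i‖ ≤ B) →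
      (∀ i, ‖e i‖ ≤ B) → ‖gammaKernel (fun i => a i + n) (fun i => e i + n)‖ ≤ C := fun n => by
    have hd : Differentiable ℂ fun p : (Fin 4 → ℂ) × (Fin 4 → ℂ) =>
        gammaKernel (fun i => p.1 i + n) (fun i => p.2 i + n) :=
      differentiable_gammaKernel (fun i => by fun_prop) (fun i => by fun_prop)
    obtain ⟨C, hC⟩ := ((isCompact_univ_pi fun _ : Fin 4 => isCompact_closedBall (0 : ℂ) B).prod
      (isCompact_univ_pi fun _ : Fin 4 => isCompact_closedBall (0 : ℂ) B)).exists_bound_of_continuousOn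
        hd.continuous.continuousOn
    refine ⟨max C 0, le_max_right _ _, fun a e ha he => (hC (a, e) ?_).trans (le_max_left _ _)⟩
    simpa using ⟨ha, he⟩
  choose C hC0 hC using hcpt
  set E := M * ∑' j : ℕ, 1 / ((j : ℝ) + 1) ^ 2 with hE
  refine ⟨∑ n ∈ range (N + 1), C n * ((n : ℝ) + 1) ^ 2 + 4 * Real.exp E * (N ^ 2 * C N),
    add_nonneg (sum_nonneg fun n _ => mul_nonneg (hC0 n) (by positivity))
      (mul_nonneg (by positivity) (mul_nonneg (by positivity) (hC0 N))),
    fun a e ha he hae n => ?_⟩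
  rw [mul_one_div, le_div_iff₀ (by positivity)]
  have hN1 : (1 : ℝ) ≤ N := hR.trans hN
  rcases lt_or_ge n (N + 1) with hn | hn
  · refine le_add_of_le_of_nonneg ?_ (mul_nonneg (by positivity) (mul_nonneg (by positivity) (hC0 N)))
    refine (mul_le_mul_of_nonneg_right (hC n a e ha he) (by positivity)).trans ?_
    exact single_le_sum (f := fun n : ℕ => C n * ((n : ℝ) + 1) ^ 2)
      (fun m _ => mul_nonneg (hC0 m) (by positivity)) (mem_range.2 hn)
  · refine le_add_of_nonneg_of_le (sum_nonneg fun n _ => mul_nonneg (hC0 n) (by positivity)) ?_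
    obtain ⟨m, rfl⟩ := Nat.exists_eq_add_of_le (by lia : N ≤ n)
    have h1 := norm_le_exp_sum_mul (v := fun j => scaledKernel a e ((N + j : ℕ) : ℂ))
      (c := fun j => M * (1 / ((j : ℝ) + 1) ^ 2)) (E := E)
      (fun n => by
        rw [← mul_sum]
        exact mul_le_mul_of_nonneg_left
          (summable_inv_add_one_sq.sum_le_tsum _ fun _ _ => by positivity) hM)
      (fun j => by
        have h2 := (h a e ha he hae ((N + j : ℕ) : ℂ) (by
          rw [Complex.norm_natCast]; push_cast; linarith [Nat.cast_nonneg (α := ℝ) j])).1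
        rw [Complex.norm_natCast] at h2
        rw [← add_assoc, Nat.cast_succ]
        refine h2.trans (mul_le_mul_of_nonneg_right ?_ (norm_nonneg _))
        rw [mul_one_div]
        gcongr
        push_cast
        linarith) m
    simp only [scaledKernel, norm_mul, norm_pow, Complex.norm_natCast, add_zero] at h1
    set g := ‖gammaKernel (fun i => a i + ((N + m : ℕ) : ℂ)) (fun i => e i + ((N + m : ℕ) : ℂ))‖
    have h3 : (((N + m : ℕ) : ℝ) + 1) ^ 2 ≤ 4 * ((N + m : ℕ) : ℝ) ^ 2 := by
      push_cast
      nlinarith [Nat.cast_nonneg (α := ℝ) m]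
    calc _ ≤ g * (4 * ((N + m : ℕ) : ℝ) ^ 2) := by gcongr
      _ = 4 * (((N + m : ℕ) : ℝ) ^ 2 * g) := by ring
      _ ≤ 4 * (Real.exp E * (N ^ 2 * C N)) := by
        refine mul_le_mul_of_nonneg_left (h1.trans ?_) (by norm_num)
        gcongr
        exact hC N a e ha he
      _ = _ := by ring

lemma exists_norm_gammaKernel_int_le (B : ℝ) : ∃ C : ℝ, ∀ a e : Fin 4 → ℂ,
    (∀ i, ‖a i‖ ≤ B) → (∀ i, ‖e i‖ ≤ B) → ∑ i, e i - ∑ i, a i = 2 → ∀ n : ℤ,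
      ‖gammaKernel (fun i => a i + n) (fun i => e i + n)‖ ≤
        C * (1 / ((n.natAbs : ℝ) + 1) ^ 2) := by
  obtain ⟨C, hC0, h⟩ := exists_norm_gammaKernel_nat_le (1 + B)
  refine ⟨C, fun a e ha he hae n => ?_⟩
  have hsub : ∀ x : ℂ, ‖x‖ ≤ B → ‖1 - x‖ ≤ 1 + B := fun x hx => by
    refine (norm_sub_le _ _).trans ?_
    rw [norm_one]
    linarith
  obtain ⟨m, rfl | rfl⟩ := n.eq_nat_or_neg
  · simpa using h a e (fun i => (ha i).trans (by linarith)) (fun i => (he i).trans (by linarith))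
      hae m
  · have h1 := h (fun i => 1 - e i) (fun i => 1 - a i) (fun i => hsub _ (he i))
      (fun i => hsub _ (ha i)) (by rw [sum_sub_distrib, sum_sub_distrib]; linear_combination hae) m
    rw [← gammaKernel_reflect]
    simpa [sub_eq_add_neg, add_assoc, add_comm, add_left_comm] using h1

lemma summable_natAbs_add_one_sq : Summable fun n : ℤ => 1 / ((n.natAbs : ℝ) + 1) ^ 2 := by
  refine Summable.of_nat_of_neg ?_ ?_ <;> simpa using summable_inv_add_one_sq

theorem differentiable_bilateralSum {a e : Fin 4 → ℂ → ℂ} (ha : ∀ i, Differentiable ℂ (a i))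
    (he : ∀ i, Differentiable ℂ (e i)) (hae : ∀ t, ∑ i, e i t - ∑ i, a i t = 2) :
    Differentiable ℂ fun t => bilateralSum (fun i => a i t) (fun i => e i t) := by
  intro t₀
  have hbd : ∀ f : Fin 4 → ℂ → ℂ, (∀ i, Differentiable ℂ (f i)) → ∃ B : ℝ, 0 ≤ B ∧
      ∀ i, ∀ t ∈ Metric.ball t₀ 1, ‖f i t‖ ≤ B := fun f hf => by
    have h1 : ∀ i, ∃ B : ℝ, ∀ t ∈ Metric.closedBall t₀ 1, ‖f i t‖ ≤ B := fun i =>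
      (isCompact_closedBall t₀ 1).exists_bound_of_continuousOn (hf i).continuous.continuousOn
    choose B hB using h1
    refine ⟨∑ i, |B i|, by positivity, fun i t ht => ?_⟩
    refine (hB i t (Metric.ball_subset_closedBall ht)).trans ((le_abs_self _).trans ?_)
    exact single_le_sum (f := fun i => |B i|) (fun i _ => abs_nonneg _) (mem_univ i)
  obtain ⟨B, hB0, hB⟩ := hbd a ha
  obtain ⟨B', hB0', hB'⟩ := hbd e he
  obtain ⟨C, hC⟩ := exists_norm_gammaKernel_int_le (B + B')
  refine (differentiableOn_tsum_of_summable_norm (summable_natAbs_add_one_sq.mul_left C)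
    (fun n => ?_) Metric.isOpen_ball fun n t ht => hC _ _ (fun i => (hB i t ht).trans (by linarith))
      (fun i => (hB' i t ht).trans (by linarith)) (hae t) n).differentiableAt
        (Metric.ball_mem_nhds t₀ one_pos)
  exact (differentiable_gammaKernel (a := fun i t => a i t + n) (e := fun i t => e i t + n)
    (fun i => (ha i).add_const _) (fun i => (he i).add_const _)).differentiableOn

lemma bilateralSum_add_int (a e : Fin 4 → ℂ) (m : ℤ) :
    bilateralSum (fun i => a i + m) (fun i => e i + m) = bilateralSum a e := by
  unfold bilateralSum
  rw [← (Equiv.addLeft m).tsum_eq fun n : ℤ => gammaKernel (fun i => a i + n) (fun i => e i + n)]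
  simp only [Equiv.coe_addLeft, Int.cast_add, add_assoc]

lemma bilateralSum_reflect (a e : Fin 4 → ℂ) :
    bilateralSum (fun i => 1 - e i) (fun i => 1 - a i) = bilateralSum a e := by
  unfold bilateralSum
  rw [← (Equiv.neg ℤ).tsum_eq]
  refine tsum_congr fun n => ?_
  rw [← gammaKernel_reflect]
  simp [sub_add_eq_sub_sub]

lemma norm_sin_le_exp_abs_im (w : ℂ) : ‖Complex.sin w‖ ≤ Real.exp |w.im| := by
  have h1 : ‖cexp (-w * I)‖ ≤ Real.exp |w.im| := by
    rw [Complex.norm_exp]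
    simpa using le_abs_self w.im
  have h2 : ‖cexp (w * I)‖ ≤ Real.exp |w.im| := by
    rw [Complex.norm_exp]
    simpa using neg_le_abs w.im
  rw [Complex.sin, norm_div, norm_mul, Complex.norm_I, mul_one, Complex.norm_two]
  linarith [norm_sub_le (cexp (-w * I)) (cexp (w * I))]

lemma inv_Gamma_one_sub {w : ℂ} (hw : w.im ≠ 0) :
    (Gamma (1 - w))⁻¹ = Gamma w * (Complex.sin (Real.pi * w) / Real.pi) := by
  have h := Complex.Gamma_mul_Gamma_one_sub w
  have h1 : Gamma (1 - w) ≠ 0 := Complex.Gamma_ne_zero fun m hm => hw (by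
    have := congrArg Complex.im hm
    simpa using this)
  have hpi : (Real.pi : ℂ) ≠ 0 := by exact_mod_cast Real.pi_ne_zero
  have hs : Complex.sin (Real.pi * w) ≠ 0 := by
    rw [Complex.sin_ne_zero_iff]
    intro k hk
    rw [mul_comm, mul_left_inj' hpi] at hk
    exact hw (by rw [hk]; simp)
  rw [eq_div_iff hs] at h
  rw [inv_eq_of_mul_eq_one_right]
  rw [← mul_assoc, ← mul_div_assoc, div_eq_one_iff_eq hpi]
  linear_combination h

lemma tendsto_norm_scaledKernel {a e : Fin 4 → ℂ} (hae : ∑ i, e i - ∑ i, a i = 2) {s : ℂ}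
    (ha : ∀ i, (a i + s).im ≠ 0) (he : ∀ i, (e i + s).im ≠ 0) :
    Tendsto (fun n : ℕ => ‖scaledKernel a e (s + n)‖) atTop
      (𝓝 (∏ i, ‖Complex.sin (Real.pi * (a i + s))‖ / Real.pi)) := by
  have hne : ∀ x : ℂ, x.im ≠ 0 → ∀ m : ℕ, x - 1 ≠ -m := fun x hx m hm => hx (by
    have := congrArg Complex.im hm
    simpa using this)
  have h1 := tendsto_cpow_mul_prod_Gamma_div (fun i => a i + s - 1) (fun i => e i + s - 1)
    (fun i => hne _ (ha i)) (fun i => hne _ (he i))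
  have h2 : ∑ i, (e i + s - 1) - ∑ i, (a i + s - 1) = 2 := by
    simp only [sum_sub_distrib, sum_add_distrib]
    linear_combination hae
  rw [h2] at h1
  have h3 : Tendsto (fun n : ℕ => ((s + n) / n) ^ 2) atTop (𝓝 1) := by
    have h4 : Tendsto (fun n : ℕ => s / (n : ℂ) + 1) atTop (𝓝 (0 + 1)) :=
      (tendsto_const_div_atTop_nhds_zero_nat s).add_const 1
    rw [zero_add] at h4
    have h5 := h4.pow 2
    rw [one_pow] at h5
    refine h5.congr' ?_
    filter_upwards [eventually_gt_atTop 0] with n hn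
    have : (n : ℂ) ≠ 0 := by exact_mod_cast hn.ne'
    rw [add_div, div_self this]
  have h6 := ((h3.mul h1).norm).mul_const (∏ i, ‖Complex.sin (Real.pi * (a i + s))‖ / Real.pi)
  rw [mul_one, norm_one, one_mul] at h6
  refine h6.congr' ?_
  filter_upwards [eventually_gt_atTop 0] with n hn
  have hn0 : (n : ℂ) ≠ 0 := by exact_mod_cast hn.ne'
  have hsin : ∀ x : ℂ, ‖Complex.sin (Real.pi * (x + n))‖ = ‖Complex.sin (Real.pi * x)‖ := by
    intro x
    rw [mul_add, mul_comm (Real.pi : ℂ) n, Complex.sin_antiperiodic.add_nat_mul_eq]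
    simp
  have hker : gammaKernel (fun i => a i + (s + n)) (fun i => e i + (s + n)) =
      ∏ i, Gamma (a i + s - 1 + n + 1) / Gamma (e i + s - 1 + n + 1) *
        (Complex.sin (Real.pi * (a i + s + n)) / Real.pi) := by
    refine prod_congr rfl fun i _ => ?_
    rw [inv_Gamma_one_sub (by simpa using ha i), show a i + s - 1 + n + 1 = a i + (s + n) by ring,
      show e i + s - 1 + n + 1 = e i + (s + n) by ring, add_assoc]
    ring
  rw [scaledKernel, hker, prod_mul_distrib, norm_mul, norm_mul, norm_mul, norm_mul, norm_prod _
    (fun i => Complex.sin (Real.pi * (a i + s + n)) / Real.pi)]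
  simp only [norm_div, hsin, Complex.norm_real, Real.norm_eq_abs, abs_of_pos Real.pi_pos]
  rw [← mul_assoc, ← mul_assoc]
  congr 2
  rw [Complex.cpow_ofNat, norm_pow, norm_pow, norm_pow, norm_div, div_pow, div_mul_cancel₀]
  exact pow_ne_zero _ (norm_ne_zero_iff.2 hn0)

lemma exists_norm_scaledKernel_le_of_re_nonneg {a e : Fin 4 → ℂ} (hae : ∑ i, e i - ∑ i, a i = 2) :
    ∃ C R : ℝ, 1 ≤ R ∧ ∀ s : ℂ, 0 ≤ s.re → R ≤ |s.im| →
      ‖scaledKernel a e s‖ ≤ C * Real.exp (4 * Real.pi * |s.im|) := by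
  set B := ∑ i, ‖a i‖ + ∑ i, ‖e i‖ with hB
  have ha : ∀ i, ‖a i‖ ≤ B := fun i => by
    have := single_le_sum (f := fun i => ‖a i‖) (fun i _ => norm_nonneg _) (mem_univ i)
    exact this.trans (le_add_of_nonneg_right (by positivity))
  have he : ∀ i, ‖e i‖ ≤ B := fun i => by
    have := single_le_sum (f := fun i => ‖e i‖) (fun i _ => norm_nonneg _) (mem_univ i)
    exact this.trans (le_add_of_nonneg_left (by positivity))
  obtain ⟨M, R, hM, hR, h⟩ := exists_norm_scaledKernel_add_one_le B
  set E := 2 * M * ∑' j : ℕ, 1 / ((j : ℝ) + 1) ^ 2 with hE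
  refine ⟨Real.exp E * Real.exp (4 * Real.pi * B), max R (B + 1), hR.trans (le_max_left _ _),
    fun s hs hsR => ?_⟩
  have hR1 : R ≤ |s.im| := (le_max_left _ _).trans hsR
  have hB1 : B + 1 ≤ |s.im| := (le_max_right _ _).trans hsR
  have him : ∀ x : ℂ, ‖x‖ ≤ B → (x + s).im ≠ 0 := fun x hx h0 => by
    rw [Complex.add_im] at h0
    have h1 : |s.im| = |x.im| := by rw [eq_neg_of_add_eq_zero_right h0, abs_neg]
    linarith [Complex.abs_im_le_norm x]
  have hlow : ∀ j : ℕ, |s.im| ≤ ‖s + j‖ ∧ ((j : ℝ) + 1) ^ 2 ≤ 2 * ‖s + j‖ ^ 2 := fun j => by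
    refine ⟨by simpa using Complex.abs_im_le_norm (s + j), ?_⟩
    rw [Complex.sq_norm, Complex.normSq_apply]
    simp only [add_re, natCast_re, add_im, natCast_im, add_zero]
    have hj := Nat.cast_nonneg (α := ℝ) j
    have : 1 ≤ s.im * s.im := by
      rw [← abs_mul_abs_self]
      nlinarith
    nlinarith [mul_nonneg hs hj, mul_nonneg hs hs, sq_nonneg ((j : ℝ) - 1)]
  have h1 : ∀ n : ℕ, ‖scaledKernel a e s‖ ≤ Real.exp E * ‖scaledKernel a e (s + n)‖ := fun n => by
    have := norm_zero_le_exp_sum_mul (v := fun j : ℕ => scaledKernel a e (s + j))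
      (c := fun j => 2 * M * (1 / ((j : ℝ) + 1) ^ 2)) (E := E)
      (fun n => by
        rw [← mul_sum]
        exact mul_le_mul_of_nonneg_left
          (summable_inv_add_one_sq.sum_le_tsum _ fun _ _ => by positivity) (by positivity))
      (fun j => by
        have h2 := (h a e ha he hae (s + j) (hR1.trans (hlow j).1)).2
        rw [Nat.cast_succ, ← add_assoc]
        refine h2.trans (mul_le_mul_of_nonneg_right ?_ (norm_nonneg _))
        have h3 : 0 < ‖s + j‖ := by linarith [(hlow j).1]
        rw [mul_one_div, add_le_add_iff_left, div_le_div_iff₀ (by positivity) (by positivity)]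
        nlinarith [(hlow j).2]) n
    simpa using this
  have h2 := ge_of_tendsto ((tendsto_norm_scaledKernel hae (fun i => him _ (ha i))
    (fun i => him _ (he i))).const_mul (Real.exp E)) (Eventually.of_forall h1)
  refine h2.trans ?_
  rw [mul_assoc]
  refine mul_le_mul_of_nonneg_left ?_ (Real.exp_pos _).le
  have h3 : ∀ i, ‖Complex.sin (Real.pi * (a i + s))‖ / Real.pi ≤
      Real.exp (Real.pi * (B + |s.im|)) := fun i => by
    refine (div_le_self (norm_nonneg _) (by linarith [Real.pi_gt_three])).trans ?_
    refine (norm_sin_le_exp_abs_im _).trans (Real.exp_le_exp.2 ?_)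
    rw [Complex.im_ofReal_mul, abs_mul, abs_of_pos Real.pi_pos, Complex.add_im]
    gcongr
    exact (abs_add_le _ _).trans (by gcongr; exact (Complex.abs_im_le_norm _).trans (ha i))
  refine (prod_le_prod (fun i _ => by positivity) fun i _ => h3 i).trans (le_of_eq ?_)
  rw [Fin.prod_const, ← Real.exp_nat_mul, ← Real.exp_add]
  congr 1
  push_cast
  ring

lemma exists_norm_gammaKernel_add_le {a e : Fin 4 → ℂ} (hae : ∑ i, e i - ∑ i, a i = 2) :
    ∃ C R : ℝ, 0 ≤ C ∧ 1 ≤ R ∧ ∀ s : ℂ, R ≤ |s.im| →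
      ‖gammaKernel (fun i => a i + s) (fun i => e i + s)‖ * Real.exp (-(4 * Real.pi * |s.im|)) ≤
        C / ‖s‖ ^ 2 := by
  obtain ⟨C, R, hR, h⟩ := exists_norm_scaledKernel_le_of_re_nonneg hae
  obtain ⟨C', R', hR', h'⟩ := exists_norm_scaledKernel_le_of_re_nonneg (a := fun i => 1 - e i)
    (e := fun i => 1 - a i) (by rw [sum_sub_distrib, sum_sub_distrib]; linear_combination hae)
  have key : ∀ (K : ℝ) (a e : Fin 4 → ℂ) (s : ℂ), 1 ≤ |s.im| →
      ‖scaledKernel a e s‖ ≤ K * Real.exp (4 * Real.pi * |s.im|) →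
      ‖gammaKernel (fun i => a i + s) (fun i => e i + s)‖ * Real.exp (-(4 * Real.pi * |s.im|)) ≤
        K / ‖s‖ ^ 2 := by
    intro K a e s hs hK
    have hpos : 0 < ‖s‖ := by linarith [Complex.abs_im_le_norm s]
    rw [scaledKernel, norm_mul, norm_pow] at hK
    rw [Real.exp_neg, ← div_eq_mul_inv, div_le_div_iff₀ (Real.exp_pos _) (by positivity)]
    linarith
  refine ⟨max 0 (max C C'), max R R', le_max_left _ _, hR.trans (le_max_left _ _),
    fun s hs => ?_⟩
  have hs1 := hR.trans ((le_max_left _ _).trans hs)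
  rcases le_total 0 s.re with hre | hre
  · refine (key C a e s hs1 (h s hre ((le_max_left _ _).trans hs))).trans ?_
    gcongr
    exact (le_max_left _ _).trans (le_max_right _ _)
  · have h1 := key C' _ _ (-s) (by simpa using hs1)
      (h' (-s) (by simpa using hre) (by simpa using (le_max_right _ _).trans hs))
    rw [← gammaKernel_reflect]
    simp only [Complex.neg_im, abs_neg, norm_neg, ← sub_eq_add_neg, ← sub_add_eq_sub_sub] at h1 ⊢
    refine h1.trans ?_
    gcongr
    exact (le_max_right _ _).trans (le_max_right _ _)

lemma tendsto_bilateralSum_mul_exp {a e : Fin 4 → ℂ} (hae : ∑ i, e i - ∑ i, a i = 2) :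
    Tendsto (fun z => bilateralSum (fun i => a i + z) (fun i => e i + z) *
      cexp (4 * Real.pi * I * z)) (comap Complex.im atTop) (𝓝 0) := by
  obtain ⟨C, R, hC, hR, h⟩ := exists_norm_gammaKernel_add_le hae
  let w : ℂ → ℂ := fun z => z - ⌊z.re⌋
  have hw : ∀ z, (w z).im = z.im ∧ 0 ≤ (w z).re ∧ (w z).re ≤ 1 := fun z => by
    simpa [w] using (Int.fract_lt_one z.re).le
  have h1 : Tendsto (fun z => ∑' n : ℤ, gammaKernel (fun i => a i + (w z + n))
      (fun i => e i + (w z + n)) * cexp (4 * Real.pi * I * z)) (comap Complex.im atTop)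
        (𝓝 (∑' _ : ℤ, 0)) := by
    have hev : ∀ᶠ z : ℂ in comap Complex.im atTop, R ≤ z.im :=
      tendsto_comap.eventually (eventually_ge_atTop R)
    have hbd : ∀ z : ℂ, R ≤ z.im → ∀ n : ℤ, ‖gammaKernel (fun i => a i + (w z + n))
        (fun i => e i + (w z + n)) * cexp (4 * Real.pi * I * z)‖ ≤ C / ‖w z + n‖ ^ 2 := by
      intro z hz n
      have habs : |(w z + n).im| = z.im := by
        simp only [add_im, (hw z).1, intCast_im, add_zero]
        exact abs_of_nonneg (by linarith)
      have h2 := h (w z + n) (by rwa [habs])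
      rw [habs] at h2
      rw [norm_mul, Complex.norm_exp]
      simpa using h2
    refine tendsto_tsum_of_dominated_convergence
      (bound := fun n : ℤ => C * (8 * (1 / ((n.natAbs : ℝ) + 1) ^ 2)))
      ((summable_natAbs_add_one_sq.mul_left 8).mul_left C) (fun n => ?_) ?_
    · rw [tendsto_zero_iff_norm_tendsto_zero]
      have h3 : Tendsto (fun z : ℂ => C / z.im ^ 2) (comap Complex.im atTop) (𝓝 0) :=
        (((tendsto_pow_atTop two_ne_zero).comp tendsto_comap).const_div_atTop C)
      refine squeeze_zero' (Eventually.of_forall fun _ => norm_nonneg _) ?_ h3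
      filter_upwards [hev] with z hz
      refine (hbd z hz n).trans ?_
      have h4 := Complex.abs_im_le_norm (w z + n)
      simp only [add_im, (hw z).1, intCast_im, add_zero] at h4
      have h5 : 0 < z.im := by linarith
      rw [abs_of_pos h5] at h4
      gcongr
    · filter_upwards [hev] with z hz n
      refine (hbd z hz n).trans ?_
      rw [div_eq_mul_one_div]
      refine mul_le_mul_of_nonneg_left ?_ hC
      have h5 : 1 ≤ z.im := by linarith
      have h6 : ((n.natAbs : ℝ) + 1) ^ 2 ≤ 8 * ‖w z + n‖ ^ 2 := by
        rw [Complex.sq_norm, Complex.normSq_apply]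
        simp only [add_re, intCast_re, add_im, intCast_im, add_zero, (hw z).1]
        have h7 : (n.natAbs : ℝ) ^ 2 = (n : ℝ) ^ 2 := by
          rw [Nat.cast_natAbs, Int.cast_abs, sq_abs]
        nlinarith [(hw z).2.1, (hw z).2.2, sq_nonneg ((n.natAbs : ℝ) - 1),
          sq_nonneg ((n : ℝ) + 2 * (w z).re)]
      have h8 : 0 < ‖w z + n‖ ^ 2 := by
        have : (0 : ℝ) < ((n.natAbs : ℝ) + 1) ^ 2 := by positivity
        linarith
      rw [mul_one_div, div_le_div_iff₀ h8 (by positivity)]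
      linarith
  rw [tsum_zero] at h1
  refine h1.congr fun z => ?_
  rw [tsum_mul_right]
  congr 1
  have h2 := bilateralSum_add_int (fun i => a i + z) (fun i => e i + z) (-⌊z.re⌋)
  rw [← h2]
  simp [bilateralSum, w, sub_eq_add_neg, add_assoc]

theorem bilateralSum_eq_trigonometric {a e : Fin 4 → ℂ} (hae : ∑ i, e i - ∑ i, a i = 2) :
    ∃ A B C : ℂ, ∀ z, bilateralSum (fun i => a i + z) (fun i => e i + z) =
      C + A * cexp (-(2 * Real.pi * I * z)) + B * cexp (2 * Real.pi * I * z) := by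
  refine exists_eq_trigonometric ?_ (fun z => ?_) (tendsto_bilateralSum_mul_exp hae) ?_
  · refine differentiable_bilateralSum (a := fun i z => a i + z) (e := fun i z => e i + z)
      (fun i => by fun_prop) (fun i => by fun_prop) fun z => ?_
    simp only [sum_add_distrib]
    linear_combination hae
  · simpa [add_assoc] using bilateralSum_add_int (fun i => a i + z) (fun i => e i + z) 1
  · refine (tendsto_bilateralSum_mul_exp (a := fun i => 1 - e i) (e := fun i => 1 - a i)
      (by rw [sum_sub_distrib, sum_sub_distrib]; linear_combination hae)).congr fun z => ?_
    rw [← bilateralSum_reflect]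
    simp [sub_add, ← sub_eq_add_neg]

/-! ### Trigonometric identities -/

lemma Sn_eq_exp (x : ℂ) : Sn x = (cexp (-(Real.pi * I * x)) - cexp (Real.pi * I * x)) * I / 2 := by
  rw [Sn, Complex.sin]
  congr 4 <;> ring

lemma Sn_neg (x : ℂ) : Sn (-x) = -Sn x := by simp [Sn]

lemma Sn_add_one (x : ℂ) : Sn (x + 1) = -Sn x := by
  rw [Sn, Sn, mul_add, mul_one, Complex.sin_add_pi]

lemma Sn_ne_zero {x : ℂ} (hx : ∀ n : ℤ, x ≠ n) : Sn x ≠ 0 := by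
  rw [Sn, Complex.sin_ne_zero_iff]
  intro k hk
  rw [mul_comm, mul_left_inj' (by exact_mod_cast Real.pi_ne_zero)] at hk
  exact hx k hk

lemma differentiable_Sn : Differentiable ℂ Sn := by
  unfold Sn
  fun_prop

/-- Membership in the span of `1` and `exp (± 2 π i z)`. -/
def IsTrigonometric (w : ℂ → ℂ) : Prop :=
  ∃ A B C : ℂ, ∀ z, w z = C + A * cexp (-(2 * Real.pi * I * z)) + B * cexp (2 * Real.pi * I * z)

lemma IsTrigonometric.interpolation {w : ℂ → ℂ} (hw : IsTrigonometric w) (x y t z : ℂ) :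
    w z * (Sn (y - x) * Sn (t - x) * Sn (t - y)) =
      w (-x) * (Sn (z + y) * Sn (z + t) * Sn (t - y)) -
        w (-y) * (Sn (z + x) * Sn (z + t) * Sn (t - x)) +
          w (-t) * (Sn (z + x) * Sn (z + y) * Sn (y - x)) := by
  obtain ⟨A, B, C, h⟩ := hw
  have h2 : ∀ u : ℂ, cexp (2 * Real.pi * I * u) = cexp (Real.pi * I * u) ^ 2 := fun u => by
    rw [← Complex.exp_nat_mul]
    congr 1
    push_cast
    ring
  simp only [h, Sn_eq_exp, Complex.exp_neg, h2, sub_eq_add_neg, mul_add, mul_neg, Complex.exp_add]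
  have hx := Complex.exp_ne_zero (Real.pi * I * x)
  have hy := Complex.exp_ne_zero (Real.pi * I * y)
  have ht := Complex.exp_ne_zero (Real.pi * I * t)
  have hz := Complex.exp_ne_zero (Real.pi * I * z)
  generalize cexp (Real.pi * I * x) = X at *
  generalize cexp (Real.pi * I * y) = Y at *
  generalize cexp (Real.pi * I * t) = T at *
  generalize cexp (Real.pi * I * z) = Z at *
  field_simp
  ring

lemma IsTrigonometric.comp_neg {w : ℂ → ℂ} (hw : IsTrigonometric w) :
    IsTrigonometric fun z => w (-z) := by
  obtain ⟨A, B, C, h⟩ := hw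
  refine ⟨B, A, C, fun z => ?_⟩
  simp only [h, mul_neg, neg_neg]
  ring

lemma isTrigonometric_Sn_prod_sub {a b c d p q r s : ℂ} (h : p + q + r + s = a + b + c + d + 2) :
    IsTrigonometric fun z => Sn (z + a) * Sn (z + b) * Sn (z + c) * Sn (z + d) -
      Sn (z + p) * Sn (z + q) * Sn (z + r) * Sn (z + s) := by
  have h4 : ∀ x y u v : ℂ, ∃ A B C : ℂ, ∀ z, Sn (z + x) * Sn (z + y) * Sn (z + u) * Sn (z + v) =
      (cexp (Real.pi * I * z) ^ 4 * cexp (Real.pi * I * (x + y + u + v)) +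
        cexp (-(Real.pi * I * z)) ^ 4 * cexp (-(Real.pi * I * (x + y + u + v)))) / 16 +
      (C + A * cexp (-(2 * Real.pi * I * z)) + B * cexp (2 * Real.pi * I * z)) := by
    intro x y u v
    have hx := Complex.exp_ne_zero (Real.pi * I * x)
    have hy := Complex.exp_ne_zero (Real.pi * I * y)
    have hu := Complex.exp_ne_zero (Real.pi * I * u)
    have hv := Complex.exp_ne_zero (Real.pi * I * v)
    set X := cexp (Real.pi * I * x) with hX
    set Y := cexp (Real.pi * I * y) with hY
    set U := cexp (Real.pi * I * u) with hU
    set V := cexp (Real.pi * I * v) with hV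
    refine ⟨-(X ^ 2 + Y ^ 2 + U ^ 2 + V ^ 2) / (16 * X * Y * U * V),
      -(Y ^ 2 * U ^ 2 * V ^ 2 + X ^ 2 * U ^ 2 * V ^ 2 + X ^ 2 * Y ^ 2 * V ^ 2 + X ^ 2 * Y ^ 2 * U ^ 2)
        / (16 * X * Y * U * V),
      (X ^ 2 * Y ^ 2 + X ^ 2 * U ^ 2 + X ^ 2 * V ^ 2 + Y ^ 2 * U ^ 2 + Y ^ 2 * V ^ 2 + U ^ 2 * V ^ 2)
        / (16 * X * Y * U * V), fun z => ?_⟩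
    have h2 : cexp (2 * Real.pi * I * z) = cexp (Real.pi * I * z) ^ 2 := by
      rw [← Complex.exp_nat_mul]
      congr 1
      push_cast
      ring
    simp only [Sn_eq_exp, Complex.exp_neg, h2, mul_add, Complex.exp_add, ← hX, ← hY, ← hU, ← hV]
    have hz := Complex.exp_ne_zero (Real.pi * I * z)
    generalize cexp (Real.pi * I * z) = Z at *
    field_simp
    rw [Complex.I_pow_four]
    ring
  obtain ⟨A, B, C, h5⟩ := h4 a b c d
  obtain ⟨A', B', C', h6⟩ := h4 p q r s
  refine ⟨A - A', B - B', C - C', fun z => ?_⟩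
  have h7 : cexp (Real.pi * I * (p + q + r + s)) = cexp (Real.pi * I * (a + b + c + d)) := by
    rw [h, mul_add _ _ 2, Complex.exp_add, show (Real.pi : ℂ) * I * 2 = 2 * Real.pi * I by ring,
      Complex.exp_two_pi_mul_I, mul_one]
  beta_reduce
  rw [h5, h6, Complex.exp_neg (Real.pi * I * (p + q + r + s)), h7, ← Complex.exp_neg]
  ring

lemma Sn_mul_Sn_sub (x y t : ℂ) :
    Sn (x - t) * Sn y - Sn (y - t) * Sn x = Sn t * Sn (x - y) := by
  simp only [Sn, mul_sub, Complex.sin_sub]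
  ring

lemma Sn_three_point {a b c d e f g : ℂ} (h : e + f + g = a + b + c + d + 1) :
    (Sn (b - a) * Sn (c - a) * Sn (d - a) + Sn (e - 2 * a) * Sn (f - a) * Sn (g - a)) * Sn f -
      (Sn b * Sn c * Sn d + Sn (e - a) * Sn f * Sn g) * Sn (f - a) =
        Sn (b - f) * Sn (c - f) * Sn (d - f) * Sn a := by
  obtain rfl : d = e + f + g - a - b - c - 1 := by linear_combination -h
  have h1 : cexp (Real.pi * I * 1) = -1 := by rw [mul_one, Complex.exp_pi_mul_I]
  simp only [Sn_eq_exp, Complex.exp_neg, sub_eq_add_neg, mul_add, mul_neg, Complex.exp_add, h1,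
    two_mul]
  have ha := Complex.exp_ne_zero (Real.pi * I * a)
  have hb := Complex.exp_ne_zero (Real.pi * I * b)
  have hc := Complex.exp_ne_zero (Real.pi * I * c)
  have he := Complex.exp_ne_zero (Real.pi * I * e)
  have hf := Complex.exp_ne_zero (Real.pi * I * f)
  have hg := Complex.exp_ne_zero (Real.pi * I * g)
  generalize cexp (Real.pi * I * a) = A at *
  generalize cexp (Real.pi * I * b) = B at *
  generalize cexp (Real.pi * I * c) = C at *
  generalize cexp (Real.pi * I * e) = E at *
  generalize cexp (Real.pi * I * f) = F at *
  generalize cexp (Real.pi * I * g) = G at *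
  field_simp
  ring

/-! ### Values of the bilateral series -/

lemma inv_Gamma_one_sub_eq_Sn {x : ℂ} (hx : ∀ n : ℤ, x ≠ n) :
    (Gamma (1 - x))⁻¹ = Gamma x * (Sn x / Real.pi) := by
  have h := Complex.Gamma_mul_Gamma_one_sub x
  have hpi : (Real.pi : ℂ) ≠ 0 := by exact_mod_cast Real.pi_ne_zero
  have hs := Sn_ne_zero hx
  rw [← Sn, eq_div_iff hs] at h
  rw [inv_eq_of_mul_eq_one_right]
  rw [← mul_assoc, ← mul_div_assoc, div_eq_one_iff_eq hpi]
  linear_combination h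

lemma Sn_add_nat (x : ℂ) (n : ℕ) : Sn (x + n) = (-1) ^ n * Sn x := by
  rw [Sn, mul_add, mul_comm (Real.pi : ℂ) n, Complex.sin_antiperiodic.add_nat_mul_eq, Sn]

/-- The bilateral series with its eight parameters listed. -/
def bilat (a b c d p q r s : ℂ) : ℂ := bilateralSum ![a, b, c, d] ![p, q, r, s]

lemma bilat_eq_tsum (a b c d p q r s : ℂ) : bilat a b c d p q r s = ∑' n : ℤ,
    ((Gamma (1 - (a + n)))⁻¹ * (Gamma (1 - (b + n)))⁻¹ * (Gamma (1 - (c + n)))⁻¹ *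
      (Gamma (1 - (d + n)))⁻¹) * ((Gamma (p + n))⁻¹ * (Gamma (q + n))⁻¹ * (Gamma (r + n))⁻¹ *
        (Gamma (s + n))⁻¹) := by
  refine tsum_congr fun n => ?_
  simp only [gammaKernel, Fin.prod_univ_four, Matrix.cons_val]
  ring

lemma bilat_add_one (a b c d p q r s : ℂ) :
    bilat (a + 1) (b + 1) (c + 1) (d + 1) (p + 1) (q + 1) (r + 1) (s + 1) =
      bilat a b c d p q r s := by
  rw [bilat_eq_tsum, bilat_eq_tsum, ← (Equiv.addRight (1 : ℤ)).tsum_eq fun n : ℤ =>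
    ((Gamma (1 - (a + n)))⁻¹ * (Gamma (1 - (b + n)))⁻¹ * (Gamma (1 - (c + n)))⁻¹ *
      (Gamma (1 - (d + n)))⁻¹) * ((Gamma (p + n))⁻¹ * (Gamma (q + n))⁻¹ * (Gamma (r + n))⁻¹ *
        (Gamma (s + n))⁻¹)]
  simp only [Equiv.coe_addRight, Int.cast_add, Int.cast_one, add_assoc, add_comm (1 : ℂ)]

lemma bilat_reflect (a b c d p q r s : ℂ) :
    bilat (1 - p) (1 - q) (1 - r) (1 - s) (1 - a) (1 - b) (1 - c) (1 - d) =
      bilat a b c d p q r s := by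
  rw [bilat, bilat, ← bilateralSum_reflect ![a, b, c, d]]
  congr 1 <;> · ext i; fin_cases i <;> rfl

lemma bilat_swap_left (a b c d p q r s : ℂ) : bilat b a c d p q r s = bilat a b c d p q r s := by
  simp only [bilat_eq_tsum]
  exact tsum_congr fun n => by ring

lemma bilat_swap_right_fst_snd (a b c d p q r s : ℂ) :
    bilat a b c d q p r s = bilat a b c d p q r s := by
  simp only [bilat_eq_tsum]
  exact tsum_congr fun n => by ring

lemma bilat_swap_right_snd_trd (a b c d p q r s : ℂ) :
    bilat a b c d p r q s = bilat a b c d p q r s := by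
  simp only [bilat_eq_tsum]
  exact tsum_congr fun n => by ring

lemma bilat_swap_right_fst_trd (a b c d p q r s : ℂ) :
    bilat a b c d r q p s = bilat a b c d p q r s := by
  simp only [bilat_eq_tsum]
  exact tsum_congr fun n => by ring

lemma bilat_swap_right_fst_last (a b c d p q r s : ℂ) :
    bilat a b c d s q r p = bilat a b c d p q r s := by
  simp only [bilat_eq_tsum]
  exact tsum_congr fun n => by ring

lemma bilat_one {a b c d : ℂ} (ha : ∀ n : ℤ, a ≠ n) (hb : ∀ n : ℤ, b ≠ n) (hc : ∀ n : ℤ, c ≠ n)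
    (hd : ∀ n : ℤ, d ≠ n) (e f g : ℂ) :
    bilat a b c d 1 e f g = Sn a * Sn b * Sn c * Sn d / Real.pi ^ 4 * Fstar a b c d e f g := by
  rw [bilat_eq_tsum, Fstar, ← tsum_mul_left, ← (Nat.cast_injective (R := ℤ)).tsum_eq]
  · refine tsum_congr fun n => ?_
    have hn : ∀ x : ℂ, (∀ m : ℤ, x ≠ m) → (Gamma (1 - (x + ((n : ℤ) : ℂ))))⁻¹ =
        Gamma (n + x) * ((-1) ^ n * Sn x / Real.pi) := fun x hx => by
      rw [Int.cast_natCast, inv_Gamma_one_sub_eq_Sn fun m hm => hx (m - n) (by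
        push_cast
        linear_combination hm), Sn_add_nat, add_comm x]
    have h1 : ((-1 : ℂ) ^ n) ^ 4 = 1 := by
      rw [← pow_mul, mul_comm, pow_mul]
      norm_num
    rw [hn a ha, hn b hb, hn c hc, hn d hd, Int.cast_natCast, add_comm 1, Complex.Gamma_nat_eq_factorial,
      add_comm e, add_comm f, add_comm g, div_eq_mul_inv _ (_ * _ * _ * _), mul_inv, mul_inv, mul_inv]
    linear_combination (Gamma (n + a) * Gamma (n + b) * Gamma (n + c) * Gamma (n + d) *
      (Sn a * Sn b * Sn c * Sn d) / Real.pi ^ 4 * ((n.factorial : ℂ)⁻¹ * (Gamma (n + e))⁻¹ *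
        (Gamma (n + f))⁻¹ * (Gamma (n + g))⁻¹)) * h1
  · intro n hn
    by_contra hneg
    refine hn ?_
    obtain ⟨m, rfl⟩ : ∃ m : ℕ, n = -(m + 1) := by
      refine ⟨(-n - 1).toNat, ?_⟩
      have : ¬ 0 ≤ n := fun h0 => hneg ⟨n.toNat, by simp [h0]⟩
      lia
    have h0 : Gamma (1 + ((-(m + 1) : ℤ) : ℂ)) = 0 := by
      rw [Complex.Gamma_eq_zero_iff]
      exact ⟨m, by push_cast; ring⟩
    simp only [h0, inv_zero, zero_mul, mul_zero]

lemma isTrigonometric_bilat {a b c d p q r s : ℂ} (h : p + q + r + s = a + b + c + d + 2) :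
    IsTrigonometric fun z =>
      bilat (a + z) (b + z) (c + z) (d + z) (p + z) (q + z) (r + z) (s + z) := by
  obtain ⟨A, B, C, h1⟩ := bilateralSum_eq_trigonometric (a := ![a, b, c, d]) (e := ![p, q, r, s])
    (by simp only [Fin.sum_univ_four, Matrix.cons_val]; linear_combination h)
  refine ⟨A, B, C, fun z => ?_⟩
  beta_reduce
  rw [← h1, bilat]
  congr 1 <;> · ext i; fin_cases i <;> rfl

lemma differentiable_bilat {a b c d p q r s : ℂ → ℂ} (ha : Differentiable ℂ a)
    (hb : Differentiable ℂ b) (hc : Differentiable ℂ c) (hd : Differentiable ℂ d)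
    (hp : Differentiable ℂ p) (hq : Differentiable ℂ q) (hr : Differentiable ℂ r)
    (hs : Differentiable ℂ s) (h : ∀ t, p t + q t + r t + s t = a t + b t + c t + d t + 2) :
    Differentiable ℂ fun t => bilat (a t) (b t) (c t) (d t) (p t) (q t) (r t) (s t) := by
  have h1 := differentiable_bilateralSum (a := ![a, b, c, d]) (e := ![p, q, r, s])
    (fun i => by fin_cases i <;> assumption) (fun i => by fin_cases i <;> assumption)
    fun t => by simp only [Fin.sum_univ_four, Matrix.cons_val]; linear_combination h t
  have h2 : ∀ t, bilat (a t) (b t) (c t) (d t) (p t) (q t) (r t) (s t) =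
      bilateralSum (fun i => ![a, b, c, d] i t) (fun i => ![p, q, r, s] i t) := fun t => by
    rw [bilat]
    congr 1 <;> · ext i; fin_cases i <;> rfl
  rwa [funext h2]

/-! ### The two-term relation for bilateral series -/

lemma eq_zero_of_forall_Ioo {f : ℂ → ℂ} (hf : Differentiable ℂ f) {u v : ℝ} (huv : u < v)
    (h : ∀ x : ℝ, u < x → x < v → f x = 0) (z : ℂ) : f z = 0 := by
  have han : AnalyticOnNhd ℂ f Set.univ := hf.differentiableOn.analyticOnNhd isOpen_univ
  obtain ⟨m, hm1, hm2⟩ := exists_between huv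
  refine congrFun (AnalyticOnNhd.eq_of_frequently_eq (g := fun _ => (0 : ℂ)) (z₀ := (m : ℂ))
    (fun z _ => han z trivial) (fun z _ => analyticAt_const) ?_) z
  have h1 : Tendsto (fun x : ℝ => (x : ℂ)) (𝓝[>] m) (𝓝[≠] (m : ℂ)) := by
    refine tendsto_nhdsWithin_iff.2 ⟨(Complex.continuous_ofReal.tendsto m).mono_left
      nhdsWithin_le_nhds, ?_⟩
    filter_upwards [self_mem_nhdsWithin] with x hx
    simpa using (Set.mem_Ioi.1 hx).ne'
  refine h1.frequently (Eventually.frequently ?_)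
  filter_upwards [Ioo_mem_nhdsGT hm2] with x hx
  exact h x (hm1.trans hx.1) hx.2

/-- The denominator-free difference of two solutions of the bilateral series, parametrised so that
exchanging `(a, b)` with `(r, s)` is a symmetry up to Gamma factors. -/
def bilatWedge (a b r s h c : ℂ) : ℂ :=
  bilat a b c (c + h - r - s) 1 (1 + a + b - h) (c + h - s) (c + h - r) *
      (Sn (h - b) * Sn (h - a) * Sn (c + h - a - b) * Sn (c + h - a - b + h - r - s)) -
    bilat (h - b) (h - a) (c + h - a - b) (c + h - a - b + h - r - s) 1 (1 + h - a - b)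
        (c + h - a - b + h - s) (c + h - a - b + h - r) *
      (Sn a * Sn b * Sn c * Sn (c + h - r - s))

/-- The Gamma and sine factors in the symmetry of `bilatWedge`. -/
def wedgeFactor (a b h : ℂ) : ℂ :=
  Sn (h - a - b) * ((Gamma (1 - a))⁻¹ * (Gamma (1 - b))⁻¹ * (Gamma (1 - (h - a)))⁻¹ *
    (Gamma (1 - (h - b)))⁻¹)

lemma differentiable_bilatWedge {a b r s h c : ℂ → ℂ} (ha : Differentiable ℂ a)
    (hb : Differentiable ℂ b) (hr : Differentiable ℂ r) (hs : Differentiable ℂ s)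
    (hh : Differentiable ℂ h) (hc : Differentiable ℂ c) :
    Differentiable ℂ fun t => bilatWedge (a t) (b t) (r t) (s t) (h t) (c t) := by
  have hS : ∀ f : ℂ → ℂ, Differentiable ℂ f → Differentiable ℂ fun t => Sn (f t) :=
    fun f hf => differentiable_Sn.comp hf
  unfold bilatWedge
  refine .sub (.mul (differentiable_bilat ?_ ?_ ?_ ?_ ?_ ?_ ?_ ?_ fun t => by ring)
    (.mul (.mul (.mul (hS _ ?_) (hS _ ?_)) (hS _ ?_)) (hS _ ?_)))
    (.mul (differentiable_bilat ?_ ?_ ?_ ?_ ?_ ?_ ?_ ?_ fun t => by ring)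
    (.mul (.mul (.mul (hS _ ?_) (hS _ ?_)) (hS _ ?_)) (hS _ ?_))) <;> fun_prop

lemma differentiable_wedgeFactor {a b h : ℂ → ℂ} (ha : Differentiable ℂ a)
    (hb : Differentiable ℂ b) (hh : Differentiable ℂ h) :
    Differentiable ℂ fun t => wedgeFactor (a t) (b t) (h t) := by
  have hS : ∀ f : ℂ → ℂ, Differentiable ℂ f → Differentiable ℂ fun t => Sn (f t) :=
    fun f hf => differentiable_Sn.comp hf
  have hinv : ∀ f : ℂ → ℂ, Differentiable ℂ f → Differentiable ℂ fun t => (Gamma (f t))⁻¹ :=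
    fun f hf => differentiable_one_div_Gamma.comp hf
  unfold wedgeFactor
  refine .mul (hS _ ?_) (.mul (.mul (.mul (hinv _ ?_) (hinv _ ?_)) (hinv _ ?_)) (hinv _ ?_)) <;>
    fun_prop

lemma ofReal_ne_int {x : ℝ} (h0 : 0 < x) (h1 : x < 1) (n : ℤ) : (x : ℂ) ≠ n := by
  intro h
  have h2 : x = n := by exact_mod_cast h
  rw [h2] at h0 h1
  have h3 : 0 < n := by exact_mod_cast h0
  have h4 : n < 1 := by exact_mod_cast h1
  lia

lemma Fstar_ofReal (a b c e r s h : ℝ) : Fstar a b c (c + h - r - s) e (c + h - s) (c + h - r) =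
    ((∑' k, fourTerm a b c e r s h k : ℝ) : ℂ) := by
  rw [Fstar, Complex.ofReal_tsum]
  refine tsum_congr fun k => ?_
  simp only [fourTerm]
  push_cast [← Complex.Gamma_ofReal]
  ring_nf

lemma bilatWedge_ofReal {a b r s h c : ℝ} (ha : 0 < a) (ha' : a < 1 / 16) (hb : 0 < b)
    (hb' : b < 1 / 16) (hr : 0 < r) (hr' : r < 1 / 16) (hs : 0 < s) (hs' : s < 1 / 16)
    (hh : 1 / 4 < h) (hh' : h < 3 / 8) (hc : 0 < c) (hc' : c < 1 / 16) :
    bilatWedge a b r s h c = Sn a * Sn b * Sn c * Sn (c + h - r - s) *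
      (Sn (h - b) * Sn (h - a) * Sn (c + h - a - b) * Sn (c + h - a - b + h - r - s)) / Real.pi ^ 4 *
        (fourDiff a b r s h c : ℂ) := by
  have hne : ∀ x : ℝ, ∀ z : ℂ, z = x → 0 < x → x < 1 → ∀ n : ℤ, z ≠ n := fun x z hz h0 h1 n => by
    rw [hz]
    exact ofReal_ne_int h0 h1 n
  rw [bilatWedge, bilat_one (hne a _ rfl ha (by linarith)) (hne b _ rfl hb (by linarith))
    (hne c _ rfl hc (by linarith)) (hne (c + h - r - s) _ (by push_cast; rfl) (by linarith)
      (by linarith)),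
    bilat_one (hne (h - b) _ (by push_cast; rfl) (by linarith) (by linarith))
      (hne (h - a) _ (by push_cast; rfl) (by linarith) (by linarith))
      (hne (c + h - a - b) _ (by push_cast; rfl) (by linarith) (by linarith))
      (hne (c + h - a - b + h - r - s) _ (by push_cast; rfl) (by linarith) (by linarith))]
  have h1 := Fstar_ofReal a b c (1 + a + b - h) r s h
  have h2 := Fstar_ofReal (h - b) (h - a) (c + h - a - b) (1 + h - a - b) r s h
  push_cast at h1 h2
  rw [h1, h2, fourDiff]
  push_cast
  ring

lemma wedgeFactor_ofReal {a b h : ℝ} (ha : 0 < a) (ha' : a < 1 / 16) (hb : 0 < b)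
    (hb' : b < 1 / 16) (hh : 1 / 4 < h) (hh' : h < 3 / 8) :
    wedgeFactor a b h = Sn a * Sn b * Sn (h - a) * Sn (h - b) / Real.pi ^ 3 *
      ((saalConst a b h * (Real.Gamma a * Real.Gamma b) : ℝ) : ℂ) := by
  have h1 : ∀ n : ℤ, (h : ℂ) - a ≠ n := fun n => by
    exact_mod_cast ofReal_ne_int (x := h - a) (by linarith) (by linarith) n
  have h2 : ∀ n : ℤ, (h : ℂ) - b ≠ n := fun n => by
    exact_mod_cast ofReal_ne_int (x := h - b) (by linarith) (by linarith) n
  rw [wedgeFactor, inv_Gamma_one_sub_eq_Sn (ofReal_ne_int ha (by linarith)),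
    inv_Gamma_one_sub_eq_Sn (ofReal_ne_int hb (by linarith)), inv_Gamma_one_sub_eq_Sn h1,
    inv_Gamma_one_sub_eq_Sn h2, saalConst]
  push_cast [← Complex.Gamma_ofReal]
  rw [Sn]
  ring

theorem bilatWedge_symm (a b r s h c : ℂ) :
    bilatWedge a b r s h c * wedgeFactor r s h = bilatWedge r s a b h c * wedgeFactor a b h := by
  rw [← sub_eq_zero]
  have hd : ∀ {a b r s h c : ℂ → ℂ}, Differentiable ℂ a → Differentiable ℂ b → Differentiable ℂ r →
      Differentiable ℂ s → Differentiable ℂ h → Differentiable ℂ c → Differentiable ℂ fun t =>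
        bilatWedge (a t) (b t) (r t) (s t) (h t) (c t) * wedgeFactor (r t) (s t) (h t) -
          bilatWedge (r t) (s t) (a t) (b t) (h t) (c t) * wedgeFactor (a t) (b t) (h t) :=
    fun ha hb hr hs hh hc => .sub
      (.mul (differentiable_bilatWedge ha hb hr hs hh hc) (differentiable_wedgeFactor hr hs hh))
      (.mul (differentiable_bilatWedge hr hs ha hb hh hc) (differentiable_wedgeFactor ha hb hh))
  have hk : ∀ x : ℂ, Differentiable ℂ fun _ : ℂ => x := differentiable_const
  have hi : Differentiable ℂ fun z : ℂ => z := differentiable_id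
  refine eq_zero_of_forall_Ioo (u := 0) (v := 1 / 16) (hd hi (hk b) (hk r) (hk s) (hk h) (hk c))
    (by norm_num) (fun a ha ha' => ?_) a
  refine eq_zero_of_forall_Ioo (u := 0) (v := 1 / 16) (hd (hk a) hi (hk r) (hk s) (hk h) (hk c))
    (by norm_num) (fun b hb hb' => ?_) b
  refine eq_zero_of_forall_Ioo (u := 0) (v := 1 / 16) (hd (hk a) (hk b) hi (hk s) (hk h) (hk c))
    (by norm_num) (fun r hr hr' => ?_) r
  refine eq_zero_of_forall_Ioo (u := 0) (v := 1 / 16) (hd (hk a) (hk b) (hk r) hi (hk h) (hk c))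
    (by norm_num) (fun s hs hs' => ?_) s
  refine eq_zero_of_forall_Ioo (u := 1 / 4) (v := 3 / 8) (hd (hk a) (hk b) (hk r) (hk s) hi (hk c))
    (by norm_num) (fun h hh hh' => ?_) h
  refine eq_zero_of_forall_Ioo (u := 0) (v := 1 / 16) (hd (hk a) (hk b) (hk r) (hk s) (hk h) hi)
    (by norm_num) (fun c hc hc' => ?_) c
  rw [bilatWedge_ofReal ha ha' hb hb' hr hr' hs hs' hh hh' hc hc',
    bilatWedge_ofReal hr hr' hs hs' ha ha' hb hb' hh hh' hc hc',
    wedgeFactor_ofReal ha ha' hb hb' hh hh', wedgeFactor_ofReal hr hr' hs hs' hh hh']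
  have key := congrArg (fun x : ℝ => (x : ℂ)) (fourDiff_symm (c := c) ha hb hr hs
    (by linarith : a + b < h) (by linarith : r + s < h) (by linarith) hc (by linarith))
  push_cast at key ⊢
  rw [show (c : ℂ) + h - r - s + h - a - b = c + h - a - b + h - r - s by ring]
  linear_combination (Sn a * Sn b * Sn c * Sn (c + h - r - s) *
    (Sn (h - b) * Sn (h - a) * Sn (c + h - a - b) * Sn (c + h - a - b + h - r - s)) / Real.pi ^ 4) *
      (Sn r * Sn s * Sn (h - r) * Sn (h - s) / Real.pi ^ 3) * key

/-! ### Reduction of the three-term relation to trigonometric interpolation -/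

lemma Sn_sub_comm (x y : ℂ) : Sn (x - y) = -Sn (y - x) := by
  rw [← Sn_neg, neg_sub]

lemma Sn_zero : Sn 0 = 0 := by simp [Sn]

lemma Sn_one_add_sub (x y : ℂ) : Sn (1 + x - y) = Sn (y - x) := by
  rw [show 1 + x - y = -(y - x) + 1 by ring, Sn_add_one, Sn_neg, neg_neg]

lemma Sn_one_sub (x : ℂ) : Sn (1 - x) = Sn x := by
  simpa using Sn_one_add_sub 0 x

lemma bilatWedge_eq {a b c d e f g : ℂ} (h : e + f + g = a + b + c + d + 1) :
    bilatWedge (1 - a) (1 - b) (1 + d - f) (1 + d - g) (1 + e - a - b) (1 - c) =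
      bilat (1 - a) (1 - b) (1 - c) (1 - d) 1 (2 - e) (2 - f) (2 - g) *
          (Sn (e - a) * Sn (e - b) * Sn (e - c) * Sn (e - d)) -
        bilat (e - a) (e - b) (e - c) (e - d) 1 e (1 + e - f) (1 + e - g) *
          (Sn a * Sn b * Sn c * Sn d) := by
  obtain rfl : g = a + b + c + d + 1 - e - f := by linear_combination h
  rw [bilatWedge, ← Sn_one_sub a, ← Sn_one_sub b, ← Sn_one_sub c, ← Sn_one_sub d]
  ring_nf

lemma bilatWedge_eq' {a b c d e f g : ℂ} (h : e + f + g = a + b + c + d + 1) :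
    bilatWedge (1 + a - f) (1 + b - f) (e - c) (1 - c) (1 + e - c - d) (1 + d - f) =
      bilat (1 + a - f) (1 + b - f) (1 + c - f) (1 + d - f) 1 (1 + e - f) (2 - f) (1 + g - f) *
          (Sn (g - a) * Sn (g - b) * Sn (g - c) * Sn (g - d)) -
        bilat (1 + a - g) (1 + b - g) (1 + c - g) (1 + d - g) 1 (1 + e - g) (1 + f - g) (2 - g) *
          (Sn (f - a) * Sn (f - b) * Sn (f - c) * Sn (f - d)) := by
  have hperm : ∀ x y u v p q r s : ℂ, bilat x y u v p q r s = bilat x y v u p r s q := by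
    intros
    simp only [bilat_eq_tsum]
    exact tsum_congr fun n => by ring
  have hperm' : ∀ x y u v p q r s : ℂ, bilat x y u v p q r s = bilat x y v u p r q s := by
    intros
    simp only [bilat_eq_tsum]
    exact tsum_congr fun n => by ring
  rw [← Sn_one_add_sub a g, ← Sn_one_add_sub b g, ← Sn_one_add_sub c g, ← Sn_one_add_sub d g,
    ← Sn_one_add_sub a f, ← Sn_one_add_sub b f, ← Sn_one_add_sub c f, ← Sn_one_add_sub d f]
  obtain rfl : g = a + b + c + d + 1 - e - f := by linear_combination h
  rw [bilatWedge, hperm, hperm' (1 + a - (a + b + c + d + 1 - e - f))]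
  ring_nf

lemma bilatWedge_swapped_eq {a b c d e f g : ℂ} (h : e + f + g = a + b + c + d + 1) :
    bilatWedge (1 + d - f) (1 + d - g) (1 - a) (1 - b) (1 + e - a - b) (1 - c) =
      bilatWedge (e - c) (1 - c) (1 + a - f) (1 + b - f) (1 + e - c - d) (1 + d - f) := by
  have hperm : ∀ x y u v p q r s : ℂ, bilat x y u v p q r s = bilat v u x y p q s r := by
    intros
    simp only [bilat_eq_tsum]
    exact tsum_congr fun n => by ring
  obtain rfl : g = a + b + c + d + 1 - e - f := by linear_combination h
  rw [bilatWedge, bilatWedge, hperm, hperm (1 + e - a - b - _)]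
  ring_nf

/-- Elimination of the common `bilatWedge`. -/
lemma bilat_three_term {a b c d e f g : ℂ} (h : e + f + g = a + b + c + d + 1)
    (hcd : Sn (c - d) ≠ 0) :
    (bilat (1 - a) (1 - b) (1 - c) (1 - d) 1 (2 - e) (2 - f) (2 - g) *
          (Sn (e - a) * Sn (e - b) * Sn (e - c) * Sn (e - d)) -
        bilat (e - a) (e - b) (e - c) (e - d) 1 e (1 + e - f) (1 + e - g) *
          (Sn a * Sn b * Sn c * Sn d)) * Sn (g - f) *
      ((Gamma (f - a))⁻¹ * (Gamma (f - b))⁻¹ * (Gamma (f - c))⁻¹ * (Gamma (f - d))⁻¹) *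
      ((Gamma (g - a))⁻¹ * (Gamma (g - b))⁻¹ * (Gamma (g - c))⁻¹ * (Gamma (g - d))⁻¹) =
    (bilat (1 + a - f) (1 + b - f) (1 + c - f) (1 + d - f) 1 (1 + e - f) (2 - f) (1 + g - f) *
          (Sn (g - a) * Sn (g - b) * Sn (g - c) * Sn (g - d)) -
        bilat (1 + a - g) (1 + b - g) (1 + c - g) (1 + d - g) 1 (1 + e - g) (1 + f - g) (2 - g) *
          (Sn (f - a) * Sn (f - b) * Sn (f - c) * Sn (f - d))) * Sn e *
      ((Gamma a)⁻¹ * (Gamma b)⁻¹ * (Gamma c)⁻¹ * (Gamma d)⁻¹) *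
      ((Gamma (1 + a - e))⁻¹ * (Gamma (1 + b - e))⁻¹ * (Gamma (1 + c - e))⁻¹ *
        (Gamma (1 + d - e))⁻¹) := by
  have hX := bilatWedge_symm (1 - a) (1 - b) (1 + d - f) (1 + d - g) (1 + e - a - b) (1 - c)
  have hY := bilatWedge_symm (1 + a - f) (1 + b - f) (e - c) (1 - c) (1 + e - c - d) (1 + d - f)
  rw [bilatWedge_eq h, bilatWedge_swapped_eq h] at hX
  rw [bilatWedge_eq' h] at hY
  have hse : Sn (1 + e - a - b - (1 - a) - (1 - b)) = -Sn e := by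
    rw [show 1 + e - a - b - (1 - a) - (1 - b) = -(1 - e) by ring, Sn_neg, Sn_one_sub]
  simp only [wedgeFactor, hse] at hX hY
  rw [show 1 + e - a - b - (1 + d - f) - (1 + d - g) = c - d by linear_combination h,
    show 1 - (1 + d - f) = f - d by ring, show 1 - (1 + d - g) = g - d by ring,
    show 1 - (1 + e - a - b - (1 + d - f)) = g - c by linear_combination -h,
    show 1 - (1 + e - a - b - (1 + d - g)) = f - c by linear_combination -h,
    show 1 - (1 - a) = a by ring, show 1 - (1 - b) = b by ring,
    show 1 - (1 + e - a - b - (1 - a)) = 1 + b - e by ring,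
    show 1 - (1 + e - a - b - (1 - b)) = 1 + a - e by ring] at hX
  rw [show 1 + e - c - d - (e - c) - (1 - c) = c - d by ring,
    show 1 - (e - c) = 1 + c - e by ring, show 1 - (1 - c) = c by ring,
    show 1 - (1 + e - c - d - (e - c)) = d by ring,
    show 1 - (1 + e - c - d - (1 - c)) = 1 + d - e by ring,
    show 1 + e - c - d - (1 + a - f) - (1 + b - f) = f - g by linear_combination h,
    show 1 - (1 + a - f) = f - a by ring, show 1 - (1 + b - f) = f - b by ring,
    show 1 - (1 + e - c - d - (1 + a - f)) = g - b by linear_combination -h,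
    show 1 - (1 + e - c - d - (1 + b - f)) = g - a by linear_combination -h,
    Sn_sub_comm f g] at hY
  refine mul_left_cancel₀ hcd ?_
  linear_combination (Sn (g - f) * ((Gamma (f - a))⁻¹ * (Gamma (f - b))⁻¹ * (Gamma (g - b))⁻¹ *
    (Gamma (g - a))⁻¹)) * hX - (Sn e * ((Gamma a)⁻¹ * (Gamma b)⁻¹ * (Gamma (1 + b - e))⁻¹ *
      (Gamma (1 + a - e))⁻¹)) * hY

lemma inv_Gamma_mul_inv_Gamma {x y : ℂ} (hx : ∀ n : ℤ, x ≠ n) (hxy : x + y = 1) :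
    (Gamma x)⁻¹ * (Gamma y)⁻¹ * Real.pi = Sn x := by
  have hpi : (Real.pi : ℂ) ≠ 0 := by exact_mod_cast Real.pi_ne_zero
  have hG : Gamma x ≠ 0 := Complex.Gamma_ne_zero fun m hm => hx (-m) (by simpa using hm)
  rw [eq_sub_of_add_eq' hxy, inv_Gamma_one_sub_eq_Sn hx]
  field_simp

lemma inv_Gamma_prod {a b c d a' b' c' d' : ℂ} (ha : ∀ n : ℤ, a ≠ n) (hb : ∀ n : ℤ, b ≠ n)
    (hc : ∀ n : ℤ, c ≠ n) (hd : ∀ n : ℤ, d ≠ n) (ha' : a + a' = 1) (hb' : b + b' = 1)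
    (hc' : c + c' = 1) (hd' : d + d' = 1) :
    (Gamma a)⁻¹ * (Gamma b)⁻¹ * (Gamma c)⁻¹ * (Gamma d)⁻¹ *
      ((Gamma a')⁻¹ * (Gamma b')⁻¹ * (Gamma c')⁻¹ * (Gamma d')⁻¹) * Real.pi ^ 4 =
        Sn a * Sn b * Sn c * Sn d := by
  rw [← inv_Gamma_mul_inv_Gamma ha ha', ← inv_Gamma_mul_inv_Gamma hb hb',
    ← inv_Gamma_mul_inv_Gamma hc hc', ← inv_Gamma_mul_inv_Gamma hd hd']
  ring

/-- The three-term relation, for functions known only at the interpolation nodes. -/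
lemma IsTrigonometric.three_term {a b c d e f g κ : ℂ} {P Q : ℂ → ℂ} (hP : IsTrigonometric P)
    (hQ : IsTrigonometric Q) (h : e + f + g = a + b + c + d + 1) (hf : Sn f ≠ 0)
    (hfe : Sn (f - e) ≠ 0) (hge : Sn (g - e) ≠ 0) (hgf : Sn (g - f) ≠ 0)
    (hG : Sn (g - a) * Sn (g - b) * Sn (g - c) * Sn (g - d) ≠ 0)
    (h1 : (P 0 * (Sn (e - a) * Sn (e - b) * Sn (e - c) * Sn (e - d)) -
        P (-e) * (Sn a * Sn b * Sn c * Sn d)) * Sn (g - f) *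
        (Sn (f - a) * Sn (f - b) * Sn (f - c) * Sn (f - d)) *
        (Sn (g - a) * Sn (g - b) * Sn (g - c) * Sn (g - d)) =
      κ * Sn e * (Q (-f) * (Sn (g - a) * Sn (g - b) * Sn (g - c) * Sn (g - d)) -
        Q (-g) * (Sn (f - a) * Sn (f - b) * Sn (f - c) * Sn (f - d))))
    (h2 : (P 0 * (Sn (f - a) * Sn (f - b) * Sn (f - c) * Sn (f - d)) -
        P (-f) * (Sn a * Sn b * Sn c * Sn d)) * Sn (g - e) *
        (Sn (e - a) * Sn (e - b) * Sn (e - c) * Sn (e - d)) *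
        (Sn (g - a) * Sn (g - b) * Sn (g - c) * Sn (g - d)) =
      κ * Sn f * (Q (-e) * (Sn (g - a) * Sn (g - b) * Sn (g - c) * Sn (g - d)) -
        Q (-g) * (Sn (e - a) * Sn (e - b) * Sn (e - c) * Sn (e - d)))) :
    κ * (Sn a * Sn (e - a) * Sn (f - a) * Sn (g - a) * Q 0 +
        Sn a * Sn b * Sn c * Sn d * Q (-a)) * Sn (e - a) * Sn e =
      Sn a * Sn b * Sn c * Sn d * (Sn (f - a) * Sn (g - a)) *
        ((Sn b * Sn c * Sn d + Sn (e - a) * Sn f * Sn g) *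
            (Sn a * Sn (e - a) * Sn (f - a) * Sn (g - a) * P (-e) +
              Sn (e - a) * Sn (e - b) * Sn (e - c) * Sn (e - d) * P (-a)) * Sn e -
          (Sn (b - a) * Sn (c - a) * Sn (d - a) + Sn (e - 2 * a) * Sn (f - a) * Sn (g - a)) *
            (P 0 * (Sn (e - a) * Sn (e - b) * Sn (e - c) * Sn (e - d)) -
              P (-e) * (Sn a * Sn b * Sn c * Sn d)) * Sn (e - a)) := by
  have hq := isTrigonometric_Sn_prod_sub (a := a) (b := b) (c := c) (d := d) (p := 1) (q := e)
    (r := f) (s := g) (by linear_combination h)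
  have hneg : ∀ x y : ℂ, Sn (-y + x) = -Sn (y - x) := fun x y => by
    rw [← Sn_neg, neg_sub, neg_add_eq_sub]
  have hpos : ∀ x y : ℂ, Sn (-y + x) = Sn (x - y) := fun x y => by rw [neg_add_eq_sub]
  have hq0 := hq.interpolation e f g 0
  have hqa := hq.interpolation e f g (-a)
  have hqn := hq.interpolation 0 e f (-a)
  have hQ0 := hQ.interpolation e f g 0
  have hQa := hQ.interpolation e f g (-a)
  have hPa := hP.interpolation 0 e f (-a)
  have hs1 : ∀ y, Sn (-y + 1) = Sn y := fun y => by rw [neg_add_eq_sub, Sn_one_sub]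
  have hsone : Sn 1 = 0 := by simp [Sn]
  simp only [hs1, hsone, hpos _ a, hneg _ e, hneg _ f, hneg _ g, sub_self, Sn_zero, zero_add,
    mul_zero, zero_mul, sub_zero, neg_zero, Sn_neg, add_zero] at hq0 hqa hqn hQ0 hQa hPa
  have h3 := Sn_three_point h
  have h4 := Sn_mul_Sn_sub f e a
  rw [Sn_sub_comm b f, Sn_sub_comm c f, Sn_sub_comm d f] at h3
  set E := Sn (e - a) * Sn (e - b) * Sn (e - c) * Sn (e - d) with hE
  set F := Sn (f - a) * Sn (f - b) * Sn (f - c) * Sn (f - d) with hF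
  set G := Sn (g - a) * Sn (g - b) * Sn (g - c) * Sn (g - d) with hG'
  set T := Sn b * Sn c * Sn d + Sn (e - a) * Sn f * Sn g with hT
  set T' := Sn (b - a) * Sn (c - a) * Sn (d - a) + Sn (e - 2 * a) * Sn (f - a) * Sn (g - a)
  have hL : G * (Sn (f - e) * Sn (g - e) * Sn (g - f)) *
      (Sn a * Sn (e - a) * Sn (f - a) * Sn (g - a) * Q 0 + Sn a * Sn b * Sn c * Sn d * Q (-a)) =
      Sn (g - f) * Sn a * Sn (f - a) * Sn (g - a) * T * (Q (-e) * G - Q (-g) * E) -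
        Sn (g - e) * Sn a * Sn (e - a) * Sn (g - a) *
          (Sn b * Sn c * Sn d + Sn (f - a) * Sn e * Sn g) * (Q (-f) * G - Q (-g) * F) := by
    simp only [hE, hF, hG', hT]
    linear_combination G * (Sn a * Sn (e - a) * Sn (f - a) * Sn (g - a) * hQ0 +
      Sn a * Sn b * Sn c * Sn d * hQa) - Q (-g) * (Sn a * Sn (e - a) * Sn (f - a) * Sn (g - a) * hq0 +
        Sn a * Sn b * Sn c * Sn d * hqa)
  have hW : Sn a * Sn b * Sn c * Sn d * (Sn a * Sn (e - a) * Sn (f - a) * Sn (g - a) * P (-e) +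
      E * P (-a)) * (Sn e * Sn f * Sn (f - e)) =
      (P 0 * E - P (-e) * (Sn a * Sn b * Sn c * Sn d)) * (Sn a * Sn b * Sn c * Sn d * Sn (e - a) *
        Sn (f - a) * Sn (f - e) - F * Sn a * Sn (e - a) * Sn e) +
      (P 0 * F - P (-f) * (Sn a * Sn b * Sn c * Sn d)) * (E * Sn a * Sn (e - a) * Sn e) := by
    simp only [hE, hF]
    linear_combination Sn a * Sn b * Sn c * Sn d * E * hPa -
      Sn a * Sn b * Sn c * Sn d * P (-e) * hqn
  refine mul_left_cancel₀ (mul_ne_zero (mul_ne_zero (mul_ne_zero (mul_ne_zero hfe hge) hgf) hf) hG) ?_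
  linear_combination Sn (e - a) * (κ * Sn e * Sn f * hL -
    Sn (g - f) * Sn a * Sn (f - a) * Sn (g - a) * T * Sn e * h2 +
    Sn (g - e) * Sn a * Sn (e - a) * Sn (g - a) *
      (Sn b * Sn c * Sn d + Sn (f - a) * Sn e * Sn g) * Sn f * h1) -
    Sn (f - a) * Sn (g - a) * T * Sn (g - e) * Sn (g - f) * G * hW +
    Sn (g - e) * Sn (g - f) * G * (P 0 * E - P (-e) * (Sn a * Sn b * Sn c * Sn d)) * Sn (g - a) *
      Sn (e - a) * Sn a * (Sn b * Sn c * Sn d * Sn (f - a) * Sn (f - e) * h3 +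
        F * (Sn b * Sn c * Sn d) * h4)

theorem orbit6_LKK_relation (a b c d e f g : ℂ)
    (hsaal : e + f + g = a + b + c + d + 1)
    (hint : ∀ i : Fin 7, ∀ n : ℤ, ![a, b, c, d, e, f, g] i ≠ (n : ℂ))
    (hdiff : ∀ i j : Fin 7, i ≠ j → ∀ n : ℤ,
      ![a, b, c, d, e, f, g] i - ![a, b, c, d, e, f, g] j ≠ (n : ℂ)) :
    Sn a * Af (1 + a - f) (1 + b - f) (1 + c - f) (1 + d - f) *
        Af (1 + a - g) (1 + b - g) (1 + c - g) (1 + d - g) *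
        Af (1 - a) (e - a) (f - a) (g - a) * Kf a b c d e f g -
      Af a (1 + a - e) (1 + a - f) (1 + a - g) * B4 a b c d e f g *
        Kf (e - a) (e - b) (e - c) (e - d) e (1 + e - f) (1 + e - g) -
      Af a b c d * B2 a b c d e f g *
        Lf (1 - a) (1 - b) (1 - c) (1 - d) (2 - e) (2 - f) (2 - g) = 0 := by
  have ha : ∀ n : ℤ, a ≠ n := hint 0
  have hb : ∀ n : ℤ, b ≠ n := hint 1
  have hc : ∀ n : ℤ, c ≠ n := hint 2
  have hd : ∀ n : ℤ, d ≠ n := hint 3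
  have he : ∀ n : ℤ, e ≠ n := hint 4
  have hf : ∀ n : ℤ, f ≠ n := hint 5
  have hea : ∀ n : ℤ, e - a ≠ n := hdiff 4 0 (by decide)
  have heb : ∀ n : ℤ, e - b ≠ n := hdiff 4 1 (by decide)
  have hec : ∀ n : ℤ, e - c ≠ n := hdiff 4 2 (by decide)
  have hed : ∀ n : ℤ, e - d ≠ n := hdiff 4 3 (by decide)
  have hfa : ∀ n : ℤ, f - a ≠ n := hdiff 5 0 (by decide)
  have hfb : ∀ n : ℤ, f - b ≠ n := hdiff 5 1 (by decide)
  have hfc : ∀ n : ℤ, f - c ≠ n := hdiff 5 2 (by decide)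
  have hfd : ∀ n : ℤ, f - d ≠ n := hdiff 5 3 (by decide)
  have hga : ∀ n : ℤ, g - a ≠ n := hdiff 6 0 (by decide)
  have hgb : ∀ n : ℤ, g - b ≠ n := hdiff 6 1 (by decide)
  have hgc : ∀ n : ℤ, g - c ≠ n := hdiff 6 2 (by decide)
  have hgd : ∀ n : ℤ, g - d ≠ n := hdiff 6 3 (by decide)
  have hfe : Sn (f - e) ≠ 0 := Sn_ne_zero (hdiff 5 4 (by decide))
  have hge : Sn (g - e) ≠ 0 := Sn_ne_zero (hdiff 6 4 (by decide))
  have hgf : Sn (g - f) ≠ 0 := Sn_ne_zero (hdiff 6 5 (by decide))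
  have hcd : Sn (c - d) ≠ 0 := Sn_ne_zero (hdiff 2 3 (by decide))
  have hsub : ∀ x : ℂ, (∀ n : ℤ, x ≠ n) → ∀ n : ℤ, 1 - x ≠ n := fun x hx n h =>
    hx (1 - n) (by push_cast; linear_combination -h)
  have hadd : ∀ x y : ℂ, (∀ n : ℤ, x - y ≠ n) → ∀ n : ℤ, 1 + y - x ≠ n := fun x y hx n h =>
    hx (1 - n) (by push_cast; linear_combination -h)
  have hpi : (Real.pi : ℂ) ≠ 0 := by exact_mod_cast Real.pi_ne_zero
  -- products of reciprocal Gamma values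
  have hα := inv_Gamma_prod (a' := 1 - a) (b' := 1 - b) (c' := 1 - c) (d' := 1 - d) ha hb hc hd
    (by ring) (by ring) (by ring) (by ring)
  have hE := inv_Gamma_prod (a' := 1 + a - e) (b' := 1 + b - e) (c' := 1 + c - e)
    (d' := 1 + d - e) hea heb hec hed (by ring) (by ring) (by ring) (by ring)
  have hF := inv_Gamma_prod (a' := 1 + a - f) (b' := 1 + b - f) (c' := 1 + c - f)
    (d' := 1 + d - f) hfa hfb hfc hfd (by ring) (by ring) (by ring) (by ring)
  have hG := inv_Gamma_prod (a' := 1 + a - g) (b' := 1 + b - g) (c' := 1 + c - g)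
    (d' := 1 + d - g) hga hgb hgc hgd (by ring) (by ring) (by ring) (by ring)
  have hσ := inv_Gamma_prod (a' := 1 - a) (b' := 1 + a - e) (c' := 1 + a - f)
    (d' := 1 + a - g) ha hea hfa hga (by ring) (by ring) (by ring) (by ring)
  -- the two trigonometric functions and their values at the nodes
  obtain ⟨Q, hQdef⟩ : ∃ Q : ℂ → ℂ, ∀ z, Q z =
    bilat (a + z) (b + z) (c + z) (d + z) (1 + z) (e + z) (f + z) (g + z) := ⟨_, fun _ => rfl⟩
  obtain ⟨P, hPdef⟩ : ∃ P : ℂ → ℂ, ∀ z, P z = bilat (1 - a + -z) (1 - b + -z) (1 - c + -z)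
    (1 - d + -z) (1 + -z) (2 - e + -z) (2 - f + -z) (2 - g + -z) := ⟨_, fun _ => rfl⟩
  have hQ : IsTrigonometric Q := by
    rw [funext hQdef]
    exact isTrigonometric_bilat (by linear_combination hsaal)
  have hP : IsTrigonometric P := by
    rw [funext hPdef]
    exact (isTrigonometric_bilat (a := 1 - a) (b := 1 - b) (c := 1 - c) (d := 1 - d) (p := 1)
      (q := 2 - e) (r := 2 - f) (s := 2 - g) (by linear_combination -hsaal)).comp_neg
  have hQ0 : Q 0 = bilat a b c d 1 e f g := by simp only [hQdef, add_zero]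
  have hQe : Q (-e) = bilat (1 + a - e) (1 + b - e) (1 + c - e) (1 + d - e) 1 (1 + f - e) (2 - e)
      (1 + g - e) := by
    rw [hQdef, ← bilat_add_one, bilat_swap_right_fst_snd, bilat_swap_right_snd_trd]
    congr 1 <;> ring
  have hQf : Q (-f) = bilat (1 + a - f) (1 + b - f) (1 + c - f) (1 + d - f) 1 (1 + e - f) (2 - f)
      (1 + g - f) := by
    rw [hQdef, ← bilat_add_one, bilat_swap_right_fst_trd]
    congr 1 <;> ring
  have hQg : Q (-g) = bilat (1 + a - g) (1 + b - g) (1 + c - g) (1 + d - g) 1 (1 + e - g)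
      (1 + f - g) (2 - g) := by
    rw [hQdef, ← bilat_add_one, bilat_swap_right_fst_last]
    congr 1 <;> ring
  have hQa : Q (-a) = bilat a (1 + a - e) (1 + a - f) (1 + a - g) 1 (1 + a - b) (1 + a - c)
      (1 + a - d) := by
    rw [hQdef, ← bilat_reflect]
    congr 1 <;> ring
  have hP0 : P 0 = bilat (1 - a) (1 - b) (1 - c) (1 - d) 1 (2 - e) (2 - f) (2 - g) := by
    simp only [hPdef, neg_zero, add_zero]
  have hPe : P (-e) = bilat (e - a) (e - b) (e - c) (e - d) 1 e (1 + e - f) (1 + e - g) := by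
    rw [hPdef, ← bilat_add_one (e - a), bilat_swap_right_fst_snd]
    congr 1 <;> ring
  have hPf : P (-f) = bilat (f - a) (f - b) (f - c) (f - d) 1 f (1 + f - e) (1 + f - g) := by
    rw [hPdef, ← bilat_add_one (f - a), bilat_swap_right_fst_trd, bilat_swap_right_snd_trd]
    congr 1 <;> ring
  have hPa : P (-a) = bilat (e - a) (1 - a) (f - a) (g - a) 1 (1 + b - a) (1 + c - a)
      (1 + d - a) := by
    rw [hPdef, ← bilat_reflect, ← bilat_add_one, bilat_swap_left]
    congr 1 <;> ring
  have h1 := bilat_three_term hsaal hcd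
  have h2 := bilat_three_term (a := a) (b := b) (e := f) (f := e) (g := g) (by linear_combination hsaal) hcd
  rw [← hP0, ← hPe, ← hQf, ← hQg] at h1
  rw [bilat_swap_right_snd_trd _ _ _ _ 1 (2 - e), bilat_swap_right_snd_trd _ _ _ _ 1 (1 + e - g), ← hP0,
    ← hPf, ← hQe, ← hQg] at h2
  have hsa := Sn_ne_zero ha
  have hse := Sn_ne_zero he
  have hsea := Sn_ne_zero hea
  have hsf := Sn_ne_zero hf
  have hA0 : Sn a * Sn b * Sn c * Sn d ≠ 0 :=
    mul_ne_zero (mul_ne_zero (mul_ne_zero hsa (Sn_ne_zero hb)) (Sn_ne_zero hc)) (Sn_ne_zero hd)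
  have hE0 : Sn (e - a) * Sn (e - b) * Sn (e - c) * Sn (e - d) ≠ 0 :=
    mul_ne_zero (mul_ne_zero (mul_ne_zero hsea (Sn_ne_zero heb)) (Sn_ne_zero hec))
      (Sn_ne_zero hed)
  have hG0 : Sn (g - a) * Sn (g - b) * Sn (g - c) * Sn (g - d) ≠ 0 :=
    mul_ne_zero (mul_ne_zero (mul_ne_zero (Sn_ne_zero hga) (Sn_ne_zero hgb)) (Sn_ne_zero hgc))
      (Sn_ne_zero hgd)
  obtain ⟨F₁, hF₁⟩ : ∃ x, x = Fstar a b c d e f g := ⟨_, rfl⟩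
  obtain ⟨F₂, hF₂⟩ : ∃ x, x = Fstar a (1 + a - e) (1 + a - f) (1 + a - g) (1 + a - b) (1 + a - c)
    (1 + a - d) := ⟨_, rfl⟩
  obtain ⟨F₃, hF₃⟩ : ∃ x, x = Fstar (e - a) (e - b) (e - c) (e - d) e (1 + e - f)
    (1 + e - g) := ⟨_, rfl⟩
  obtain ⟨F₄, hF₄⟩ : ∃ x, x = Fstar (e - a) (1 - a) (f - a) (g - a) (1 + b - a) (1 + c - a)
    (1 + d - a) := ⟨_, rfl⟩
  obtain ⟨F₅, hF₅⟩ : ∃ x, x = Fstar (1 - a) (1 - b) (1 - c) (1 - d) (2 - e) (2 - f)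
    (2 - g) := ⟨_, rfl⟩
  rw [bilat_one ha hb hc hd, ← hF₁] at hQ0
  rw [bilat_one ha (hadd _ _ hea) (hadd _ _ hfa) (hadd _ _ hga), ← hF₂, Sn_one_add_sub,
    Sn_one_add_sub, Sn_one_add_sub] at hQa
  rw [bilat_one (hsub _ ha) (hsub _ hb) (hsub _ hc) (hsub _ hd), ← hF₅, Sn_one_sub, Sn_one_sub,
    Sn_one_sub, Sn_one_sub] at hP0
  rw [bilat_one hea heb hec hed, ← hF₃] at hPe
  rw [bilat_one hea (hsub _ ha) hfa hga, ← hF₄, Sn_one_sub] at hPa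
  obtain ⟨α, hα'⟩ : ∃ x, x = (Gamma a)⁻¹ * (Gamma b)⁻¹ * (Gamma c)⁻¹ * (Gamma d)⁻¹ := ⟨_, rfl⟩
  obtain ⟨ε, hε'⟩ : ∃ x, x = (Gamma (1 + a - e))⁻¹ * (Gamma (1 + b - e))⁻¹ *
    (Gamma (1 + c - e))⁻¹ * (Gamma (1 + d - e))⁻¹ := ⟨_, rfl⟩
  obtain ⟨ρ, hρ'⟩ : ∃ x, x = (Gamma (1 + a - f))⁻¹ * (Gamma (1 + b - f))⁻¹ *
    (Gamma (1 + c - f))⁻¹ * (Gamma (1 + d - f))⁻¹ := ⟨_, rfl⟩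
  obtain ⟨ω, hω'⟩ : ∃ x, x = (Gamma (1 + a - g))⁻¹ * (Gamma (1 + b - g))⁻¹ *
    (Gamma (1 + c - g))⁻¹ * (Gamma (1 + d - g))⁻¹ := ⟨_, rfl⟩
  obtain ⟨γ, hγ'⟩ : ∃ x, x = (Gamma (e - a))⁻¹ * (Gamma (e - b))⁻¹ * (Gamma (e - c))⁻¹ *
    (Gamma (e - d))⁻¹ := ⟨_, rfl⟩
  have hT₁ : Sn a * Af (1 + a - f) (1 + b - f) (1 + c - f) (1 + d - f) *
        Af (1 + a - g) (1 + b - g) (1 + c - g) (1 + d - g) *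
        Af (1 - a) (e - a) (f - a) (g - a) * Kf a b c d e f g * Real.pi ^ 4 =
      α * ρ * ω * (Sn a * Sn (e - a) * Sn (f - a) * Sn (g - a)) * (F₁ + F₂) := by
    simp only [Af, Kf, ← hF₁, ← hF₂, ← hσ, hα', hρ', hω', div_eq_mul_inv, mul_inv]
    linear_combination ((Gamma (1 + a - f))⁻¹ * (Gamma (1 + b - f))⁻¹ *
      (Gamma (1 + c - f))⁻¹ * (Gamma (1 + d - f))⁻¹) * ((Gamma (1 + a - g))⁻¹ *
      (Gamma (1 + b - g))⁻¹ * (Gamma (1 + c - g))⁻¹ * (Gamma (1 + d - g))⁻¹) *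
      ((Gamma (1 - a))⁻¹ * (Gamma (e - a))⁻¹ * (Gamma (f - a))⁻¹ * (Gamma (g - a))⁻¹) *
      (F₁ + F₂) * ((Gamma a)⁻¹ ^ 2 * (Gamma b)⁻¹ * (Gamma c)⁻¹ * (Gamma d)⁻¹ *
        (Gamma (1 + a - e))⁻¹ * (Gamma (1 + a - f))⁻¹ * (Gamma (1 + a - g))⁻¹) *
      Real.pi ^ 4 * mul_inv_cancel₀ hsa
  have hT₂ : Af a (1 + a - e) (1 + a - f) (1 + a - g) * B4 a b c d e f g *
        Kf (e - a) (e - b) (e - c) (e - d) e (1 + e - f) (1 + e - g) * Real.pi ^ 8 * Sn (e - a) =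
      γ * (Sn (f - a) * Sn (g - a) * (Sn b * Sn c * Sn d + Sn (e - a) * Sn f * Sn g)) *
        (Sn a * Sn (e - a) * Sn (f - a) * Sn (g - a)) * (F₃ + F₄) := by
    have hK : Kf (e - a) (e - b) (e - c) (e - d) e (1 + e - f) (1 + e - g) * Sn (e - a) =
        (F₃ + F₄) * ((Gamma (e - a))⁻¹ ^ 2 * (Gamma (e - b))⁻¹ * (Gamma (e - c))⁻¹ *
          (Gamma (e - d))⁻¹ * (Gamma (1 - a))⁻¹ * (Gamma (f - a))⁻¹ * (Gamma (g - a))⁻¹) := by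
      rw [Kf, show 1 + (e - a) - e = 1 - a by ring, show 1 + (e - a) - (1 + e - f) = f - a by ring,
        show 1 + (e - a) - (1 + e - g) = g - a by ring,
        show 1 + (e - a) - (e - b) = 1 + b - a by ring,
        show 1 + (e - a) - (e - c) = 1 + c - a by ring,
        show 1 + (e - a) - (e - d) = 1 + d - a by ring, ← hF₃, ← hF₄]
      simp only [div_eq_mul_inv, mul_inv]
      linear_combination (F₃ + F₄) * ((Gamma (e - a))⁻¹ ^ 2 * (Gamma (e - b))⁻¹ *
        (Gamma (e - c))⁻¹ * (Gamma (e - d))⁻¹ * (Gamma (1 - a))⁻¹ * (Gamma (f - a))⁻¹ *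
        (Gamma (g - a))⁻¹) * mul_inv_cancel₀ hsea
    have hB : B4 a b c d e f g * Real.pi ^ 4 =
        Sn (f - a) * Sn (g - a) * (Sn b * Sn c * Sn d + Sn (e - a) * Sn f * Sn g) :=
      div_mul_cancel₀ _ (pow_ne_zero 4 hpi)
    rw [← hB, ← hσ, hγ']
    simp only [Af, one_div, mul_inv]
    linear_combination ((Gamma a)⁻¹ * (Gamma (1 + a - e))⁻¹ * (Gamma (1 + a - f))⁻¹ *
      (Gamma (1 + a - g))⁻¹) * B4 a b c d e f g * Real.pi ^ 8 * hK
  have hT₃ : Af a b c d * B2 a b c d e f g *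
        Lf (1 - a) (1 - b) (1 - c) (1 - d) (2 - e) (2 - f) (2 - g) * Real.pi ^ 8 * Sn e =
      -(γ * (Sn (f - a) * Sn (g - a) * (Sn (b - a) * Sn (c - a) * Sn (d - a) +
        Sn (e - 2 * a) * Sn (f - a) * Sn (g - a))) * (Sn a * Sn b * Sn c * Sn d) *
        (F₅ - F₃)) := by
    have hL : Lf (1 - a) (1 - b) (1 - c) (1 - d) (2 - e) (2 - f) (2 - g) * Sn e =
        -((F₅ - F₃) * ((Gamma (1 - a))⁻¹ * (Gamma (1 - b))⁻¹ * (Gamma (1 - c))⁻¹ *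
          (Gamma (1 - d))⁻¹ * γ)) := by
      have hshift : ∀ x : ℂ, 1 + (1 - x) - (2 - e) = e - x := fun x => by ring
      have hshift' : ∀ x : ℂ, 1 + (2 - x) - (2 - e) = 1 + e - x := fun x => by ring
      have hSe : Sn (2 - e) = -Sn e := by
        rw [show 2 - e = 1 - e + 1 by ring, Sn_add_one, Sn_one_sub]
      simp only [Lf, hshift, hshift', sub_sub_cancel, ← hF₅, ← hF₃, hSe, hγ', div_eq_mul_inv,
        mul_inv, inv_neg]
      linear_combination -(F₅ - F₃) * ((Gamma (1 - a))⁻¹ * (Gamma (1 - b))⁻¹ *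
        (Gamma (1 - c))⁻¹ * (Gamma (1 - d))⁻¹ * ((Gamma (e - a))⁻¹ * (Gamma (e - b))⁻¹ *
        (Gamma (e - c))⁻¹ * (Gamma (e - d))⁻¹)) * mul_inv_cancel₀ hse
    have hB : B2 a b c d e f g * Real.pi ^ 4 = Sn (f - a) * Sn (g - a) *
        (Sn (b - a) * Sn (c - a) * Sn (d - a) + Sn (e - 2 * a) * Sn (f - a) * Sn (g - a)) :=
      div_mul_cancel₀ _ (pow_ne_zero 4 hpi)
    rw [← hB, ← hα]
    simp only [Af, one_div, mul_inv]
    linear_combination ((Gamma a)⁻¹ * (Gamma b)⁻¹ * (Gamma c)⁻¹ * (Gamma d)⁻¹) *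
      B2 a b c d e f g * Real.pi ^ 8 * hL
  rw [← hα', ← hε'] at h1
  rw [← hα', ← hρ', ← hγ'] at h2
  rw [← hγ', ← hε'] at hE
  rw [← hρ'] at hF
  rw [← hω'] at hG
  have key := hP.three_term hQ (κ := α * ε * ρ * ω * Real.pi ^ 8) hsaal hsf hfe hge hgf hG0
    (by
      linear_combination ρ * ω * Real.pi ^ 8 * h1 -
        (P 0 * (Sn (e - a) * Sn (e - b) * Sn (e - c) * Sn (e - d)) -
          P (-e) * (Sn a * Sn b * Sn c * Sn d)) * Sn (g - f) *
        (Sn (g - a) * Sn (g - b) * Sn (g - c) * Sn (g - d)) * hF -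
        (P 0 * (Sn (e - a) * Sn (e - b) * Sn (e - c) * Sn (e - d)) -
          P (-e) * (Sn a * Sn b * Sn c * Sn d)) * Sn (g - f) *
        ((Gamma (f - a))⁻¹ * (Gamma (f - b))⁻¹ * (Gamma (f - c))⁻¹ * (Gamma (f - d))⁻¹ * ρ *
          Real.pi ^ 4) * hG)
    (by
      linear_combination ε * ω * Real.pi ^ 8 * h2 -
        (P 0 * (Sn (f - a) * Sn (f - b) * Sn (f - c) * Sn (f - d)) -
          P (-f) * (Sn a * Sn b * Sn c * Sn d)) * Sn (g - e) *
        (Sn (g - a) * Sn (g - b) * Sn (g - c) * Sn (g - d)) * hE -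
        (P 0 * (Sn (f - a) * Sn (f - b) * Sn (f - c) * Sn (f - d)) -
          P (-f) * (Sn a * Sn b * Sn c * Sn d)) * Sn (g - e) * (γ * ε * Real.pi ^ 4) * hG)
  rw [hQ0, hQa, hP0, hPe, hPa, ← hE] at key
  have hε0 : ε ≠ 0 := fun h => hE0 (by rw [← hE, h]; ring)
  have hpp := mul_inv_cancel₀ (pow_ne_zero 4 hpi)
  obtain ⟨S, hS⟩ : ∃ x, x = Sn a * Sn (e - a) * Sn (f - a) * Sn (g - a) := ⟨_, rfl⟩
  obtain ⟨A, hA⟩ : ∃ x, x = Sn a * Sn b * Sn c * Sn d := ⟨_, rfl⟩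
  obtain ⟨w, hw⟩ : ∃ x, x = Sn (f - a) * Sn (g - a) := ⟨_, rfl⟩
  obtain ⟨T, hT⟩ : ∃ x, x = Sn b * Sn c * Sn d + Sn (e - a) * Sn f * Sn g := ⟨_, rfl⟩
  obtain ⟨T', hT'⟩ : ∃ x, x = Sn (b - a) * Sn (c - a) * Sn (d - a) +
    Sn (e - 2 * a) * Sn (f - a) * Sn (g - a) := ⟨_, rfl⟩
  rw [← hS] at hT₁
  rw [← hS, ← hw, ← hT] at hT₂
  rw [← hA, ← hw, ← hT'] at hT₃
  rw [← hA] at hA0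
  have key' : α * ρ * ω * Real.pi ^ 4 * S * (F₁ + F₂) * Sn (e - a) * Sn e =
      w * γ * (T * S * (F₃ + F₄) * Sn e - T' * A * (F₅ - F₃) * Sn (e - a)) := by
    refine mul_left_cancel₀ (mul_ne_zero hA0 hε0) ?_
    rw [mul_comm (Sn (e - a)) (Sn a), ← hS, ← hA, ← hw, ← hT, ← hT'] at key
    linear_combination key - A * ε * (α * ρ * ω * Real.pi ^ 4 * S * (F₁ + F₂) * Sn (e - a) * Sn e -
      w * γ * (T * S * (F₃ + F₄) * Sn e - T' * A * (F₅ - F₃) * Sn (e - a))) * hpp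
  refine (mul_eq_zero_iff_right (mul_ne_zero (mul_ne_zero (pow_ne_zero 8 hpi) hsea) hse)).1 ?_
  linear_combination key' + Real.pi ^ 4 * Sn (e - a) * Sn e * hT₁ - Sn e * hT₂ - Sn (e - a) * hT₃
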